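/- arXiv:1105.2719 — 2 statements merged into one kernel-verified Lean document; each statement's English description precedes it below -/
import Mathlib

section
/- Let f be a conformal map of the unit disk and p ≥ 1. The function r ↦ r^{4/p} C_p(f(r𝔻)) is nonincreasing on (0,1), and is strictly decreasing unless f is linear. -/
open MeasureTheory Metric Set Real

/-- Reciprocal square of the sharp Sobolev constant of a planar domain. -/
noncomputable def Cp (p : ℝ) (D : Set ℂ) : ℝ :=
  sInf { c : ℝ | ∃ u : ℂ → ℝ, ContDiff ℝ (⊤ : ℕ∞) u ∧ HasCompactSupport u ∧
    tsupport u ⊆ D ∧ (∀ x, 0 ≤ u x) ∧ u ≠ 0 ∧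
    c = (∫ x : ℂ, ‖fderiv ℝ u x‖ ^ 2) / (∫ x : ℂ, u x ^ p) ^ (2 / p) }


theorem aux_inv {U : Set ℂ} (hU : IsOpen U) {f : ℂ → ℂ} (hf : DifferentiableOn ℂ f U)
    (hinj : InjOn f U) : ∃ k : ℂ → ℂ, (∀ z ∈ U, k (f z) = z) ∧ IsOpen (f '' U) ∧
      DifferentiableOn ℂ k (f '' U) := by
  refine ⟨Function.invFunOn f U, fun z hz => hinj.leftInvOn_invFunOn hz, ?_, ?_⟩
  all_goals
    set k := Function.invFunOn f U with hk
    have hkf : ∀ z ∈ U, k (f z) = z := fun z hz => hinj.leftInvOn_invFunOn hz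
    have han : ∀ z ∈ U, AnalyticAt ℂ f z := fun z hz => hf.analyticAt (hU.mem_nhds hz)
    have hnc : ∀ z ∈ U, ¬ ∀ᶠ w in nhds z, f w = f z := by
      intro z hz h
      have h2 : ∀ᶠ w in nhds z, w = z := by
        filter_upwards [h, hU.mem_nhds hz] with w hw hwU using hinj hwU hz hw
      have h3 : ∀ᶠ w in nhdsWithin z {z}ᶜ, False := by
        filter_upwards [h2.filter_mono nhdsWithin_le_nhds, self_mem_nhdsWithin] with w hw hw'
        exact hw' hw
      simp at h3
      exact Filter.NeBot.ne inferInstance h3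
    have hop : ∀ z ∈ U, nhds (f z) ≤ Filter.map f (nhds z) := fun z hz =>
      ((han z hz).eventually_constant_or_nhds_le_map_nhds).resolve_left (hnc z hz)
    have hnhd : ∀ z ∈ U, ∀ N ∈ nhds z, f '' N ∈ nhds (f z) := fun z hz N hN =>
      hop z hz (Filter.image_mem_map hN)
  · rw [isOpen_iff_mem_nhds]
    rintro _ ⟨z, hz, rfl⟩
    exact hnhd z hz U (hU.mem_nhds hz)
  · have hcont : ∀ z ∈ U, ContinuousAt k (f z) := by
      intro z hz
      have : Filter.map k (nhds (f z)) ≤ nhds z := by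
        refine (Filter.map_mono (hop z hz)).trans ?_
        rw [Filter.map_map]
        refine le_of_eq ?_
        conv_rhs => rw [← Filter.map_id (f := nhds z)]
        apply Filter.map_congr
        filter_upwards [hU.mem_nhds hz] with w hw using hkf w hw
      unfold ContinuousAt
      rw [hkf z hz]
      exact this
    rintro _ ⟨z, hz, rfl⟩
    apply DifferentiableAt.differentiableWithinAt
    apply AnalyticAt.differentiableAt
    refine Complex.analyticAt_of_differentiable_on_punctured_nhds_of_continuousAt ?_ (hcont z hz)
    have hd : ∀ᶠ w in nhdsWithin z {z}ᶜ, deriv f w ≠ 0 := by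
      rcases (han z hz).deriv.eventually_eq_zero_or_eventually_ne_zero with h | h
      · exfalso
        apply hnc z hz
        obtain ⟨ε, hε, hb⟩ := Metric.eventually_nhds_iff_ball.1
          (h.and (hU.mem_nhds hz))
        filter_upwards [Metric.ball_mem_nhds z hε] with w hw
        refine (convex_ball z ε).is_const_of_fderivWithin_eq_zero (𝕜 := ℂ)
          (hf.mono fun y hy => (hb y hy).2) (fun y hy => ?_) hw (mem_ball_self hε)
        rw [fderivWithin_of_isOpen isOpen_ball hy]
        ext
        simp [(hb y hy).1]
      · exact h
    rw [eventually_nhdsWithin_iff] at hd ⊢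
    have := (hd.and (hU.mem_nhds hz))
    filter_upwards [hnhd z hz _ this]
    rintro _ ⟨w, ⟨hw, hwU⟩, rfl⟩ hne
    have hwz : w ≠ z := fun h => hne (by rw [h]; rfl)
    refine (HasDerivAt.of_local_left_inverse (f' := deriv f (k (f w))) (hcont w hwU) ?_ (by rw [hkf w hwU]; exact hw hwz) (g := k) (f := f) ?_).differentiableAt
    · rw [hkf w hwU]; exact (han w hwU).differentiableAt.hasDerivAt
    · filter_upwards [hnhd w hwU _ (hU.mem_nhds hwU)]
      rintro _ ⟨y, hy, rfl⟩
      rw [hkf y hy]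

theorem aux_norm_comp (L : ℂ →L[ℝ] ℝ) (c : ℂ) :
    ‖L.comp ((ContinuousLinearMap.toSpanSingleton ℂ c).restrictScalars ℝ)‖ = ‖c‖ * ‖L‖ := by
  apply le_antisymm
  · refine ContinuousLinearMap.opNorm_le_bound _ (by positivity) fun x => ?_
    simp only [ContinuousLinearMap.comp_apply, ContinuousLinearMap.coe_restrictScalars',
      ContinuousLinearMap.toSpanSingleton_apply, smul_eq_mul]
    calc _ ≤ ‖L‖ * ‖x * c‖ := L.le_opNorm _
      _ = _ := by rw [norm_mul]; ring
  · rcases eq_or_ne c 0 with rfl | hc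
    · simp
    have hc' : 0 < ‖c‖ := norm_pos_iff.2 hc
    rw [← le_div_iff₀' hc']
    refine ContinuousLinearMap.opNorm_le_bound _ (by positivity) fun x => ?_
    have := ContinuousLinearMap.le_opNorm (L.comp ((ContinuousLinearMap.toSpanSingleton ℂ c).restrictScalars ℝ)) (x / c)
    simp only [ContinuousLinearMap.comp_apply, ContinuousLinearMap.coe_restrictScalars',
      ContinuousLinearMap.toSpanSingleton_apply, smul_eq_mul, div_mul_cancel₀ _ hc, norm_div] at this ⊢
    calc _ ≤ _ := this
      _ = _ := by ring

theorem aux_det (c : ℂ) :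
    ((ContinuousLinearMap.toSpanSingleton ℂ c).restrictScalars ℝ).det = ‖c‖ ^ 2 := by
  have h : (((ContinuousLinearMap.toSpanSingleton ℂ c).restrictScalars ℝ : ℂ →L[ℝ] ℂ) : ℂ →ₗ[ℝ] ℂ) = LinearMap.mulLeft ℝ c := by
    ext x <;> simp [mul_comm]
  rw [ContinuousLinearMap.det, h, ← LinearMap.det_toMatrix Complex.basisOneI]
  rw [Matrix.det_fin_two]
  simp [LinearMap.toMatrix_apply, ← Complex.normSq_eq_norm_sq, Complex.normSq_apply]

theorem aux_cov {U : Set ℂ} (hU : IsOpen U) {f : ℂ → ℂ} (hf : DifferentiableOn ℂ f U)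
    (hinj : InjOn f U) (F : ℂ → ℝ) :
    ∫ x in f '' U, F x = ∫ z in U, ‖deriv f z‖ ^ 2 * F (f z) := by
  rw [integral_image_eq_integral_abs_det_fderiv_smul volume hU.measurableSet
    (f' := fun z => (ContinuousLinearMap.toSpanSingleton ℂ (deriv f z)).restrictScalars ℝ) _ hinj]
  · simp [aux_det]
  · intro x hx
    have := ((hf.differentiableAt (hU.mem_nhds hx)).hasDerivAt.hasFDerivAt.restrictScalars ℝ).hasFDerivWithinAt (s := U)
    exact this

/-- test functions -/
structure IsT (D : Set ℂ) (u : ℂ → ℝ) : Prop where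
  smooth : ContDiff ℝ (⊤ : ℕ∞) u
  cpt : HasCompactSupport u
  supp : tsupport u ⊆ D
  nonneg : ∀ x, 0 ≤ u x

theorem aux_pull {U : Set ℂ} (hU : IsOpen U) {g k : ℂ → ℂ} (hg : DifferentiableOn ℂ g U)
    (hkc : ContinuousOn k (g '' U)) (hkg : ∀ z ∈ U, k (g z) = z) {u : ℂ → ℝ}
    (hu : IsT (g '' U) u) : IsT U (U.indicator (u ∘ g)) := by
  have hK : IsCompact (k '' tsupport u) := hu.cpt.isCompact.image_of_continuousOn (hkc.mono hu.supp)
  have hKU : k '' tsupport u ⊆ U := by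
    rintro _ ⟨x, hx, rfl⟩
    obtain ⟨z, hz, rfl⟩ := hu.supp hx
    rwa [hkg z hz]
  have hs : Function.support (U.indicator (u ∘ g)) ⊆ k '' tsupport u := by
    intro z hz
    have hzU : z ∈ U := by
      by_contra h; simp [h] at hz
    simp [hzU] at hz
    exact ⟨g z, subset_tsupport u hz, hkg z hzU⟩
  have hts : tsupport (U.indicator (u ∘ g)) ⊆ k '' tsupport u := closure_minimal hs hK.isClosed
  refine ⟨?_, hK.of_isClosed_subset (isClosed_tsupport _) hts, hts.trans hKU, ?_⟩
  · rw [contDiff_iff_contDiffAt]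
    intro z
    by_cases hz : z ∈ U
    · have : U.indicator (u ∘ g) =ᶠ[nhds z] u ∘ g := by
        filter_upwards [hU.mem_nhds hz] with w hw using by simp [hw]
      refine ContDiffAt.congr_of_eventuallyEq ?_ this
      refine hu.smooth.contDiffAt.comp z ?_
      exact (hg.analyticAt (hU.mem_nhds hz)).contDiffAt.restrict_scalars ℝ
    · have hz' : z ∉ tsupport (U.indicator (u ∘ g)) := fun h => hz (hKU (hts h))
      rw [notMem_tsupport_iff_eventuallyEq] at hz'
      exact contDiffAt_const.congr_of_eventuallyEq hz'
  · intro z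
    exact indicator_nonneg (fun _ _ => hu.nonneg _) z

theorem aux_setint {U : Set ℂ} {F : ℂ → ℝ} (h : Function.support F ⊆ U) :
    ∫ x, F x = ∫ x in U, F x := (setIntegral_eq_integral_of_forall_compl_eq_zero
      (fun x hx => by by_contra h'; exact hx (h h'))).symm

theorem aux_E {U : Set ℂ} (hU : IsOpen U) {g : ℂ → ℂ} (hg : DifferentiableOn ℂ g U)
    (hinj : InjOn g U) {u v : ℂ → ℝ} (hu : IsT (g '' U) u) (hv : IsT U v)
    (huv : ∀ z ∈ U, v z = u (g z)) :
    ∫ x, ‖fderiv ℝ u x‖ ^ 2 = ∫ x, ‖fderiv ℝ v x‖ ^ 2 := by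
  rw [aux_setint (U := g '' U), aux_setint (U := U) (F := fun x => ‖fderiv ℝ v x‖ ^ 2), aux_cov hU hg hinj]
  · refine setIntegral_congr_fun hU.measurableSet fun z hz => ?_
    have h1 : v =ᶠ[nhds z] u ∘ g := by
      filter_upwards [hU.mem_nhds hz] with w hw using huv w hw
    have h2 : HasFDerivAt v ((fderiv ℝ u (g z)).comp
        ((ContinuousLinearMap.toSpanSingleton ℂ (deriv g z)).restrictScalars ℝ)) z := by
      refine HasFDerivAt.congr_of_eventuallyEq ?_ h1
      refine HasFDerivAt.comp z ?_ ?_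
      · exact (hu.smooth.differentiable (by simp)).differentiableAt.hasFDerivAt
      · exact ((hg.differentiableAt (hU.mem_nhds hz)).hasDerivAt.hasFDerivAt.restrictScalars ℝ)
    rw [h2.fderiv, aux_norm_comp, mul_pow]
  · intro x hx
    apply hv.supp
    apply support_fderiv_subset ℝ
    intro h; apply hx; simp [h]
  · intro x hx
    apply hu.supp
    apply support_fderiv_subset ℝ
    intro h; apply hx; simp [h]

theorem aux_N {U : Set ℂ} (hU : IsOpen U) {g : ℂ → ℂ} (hg : DifferentiableOn ℂ g U)
    (hinj : InjOn g U) {u v : ℂ → ℝ} (hu : IsT (g '' U) u) (hv : IsT U v)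
    (huv : ∀ z ∈ U, v z = u (g z)) {p : ℝ} (hp : 1 ≤ p) :
    ∫ x, u x ^ p = ∫ x, v x ^ p * ‖deriv g x‖ ^ 2 := by
  have hp0 : p ≠ 0 := by positivity
  rw [aux_setint (U := g '' U), aux_setint (U := U) (F := fun x => v x ^ p * _), aux_cov hU hg hinj]
  · refine setIntegral_congr_fun hU.measurableSet fun z hz => ?_
    rw [huv z hz, mul_comm]
  · intro x hx
    apply hv.supp
    apply subset_tsupport
    intro h; apply hx; simp [h, hp0]
  · intro x hx
    apply hu.supp
    apply subset_tsupport
    intro h; apply hx; simp [h, hp0]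

set_option maxHeartbeats 400000 in
theorem aux_sob {p : ℝ} (hp : 1 ≤ p) : ∃ S : ℝ, 0 < S ∧ ∀ v : ℂ → ℝ, IsT (ball 0 1) v →
    ∀ η : ℝ, 0 < η → ∫ x in ball 0 η, v x ^ p ≤ S * η * (∫ x, ‖fderiv ℝ v x‖ ^ 2) ^ (p / 2) := by
  have hp0 : 0 < p := by linarith
  lift p to NNReal using hp0.le
  obtain ⟨a, ha⟩ : ∃ a : NNReal, a = 2 * p / (1 + p) := ⟨_, rfl⟩
  have hp1 : 1 ≤ p := by exact_mod_cast hp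
  have hp0' : 0 < p := by exact_mod_cast hp0
  have ha1 : 1 ≤ a := by
    rw [ha, one_le_div (by positivity), two_mul]; gcongr
  have ha2 : a < 2 := by
    rw [ha, div_lt_iff₀ (by positivity)]
    have : p < 1 + p := lt_add_of_pos_left p one_pos
    calc 2 * p < 2 * (1 + p) := by gcongr
      _ = _ := rfl
  have hpq : (a:ℝ)⁻¹ - (Module.finrank ℝ ℂ : ℝ)⁻¹ ≤ ((2 * p : NNReal) : ℝ)⁻¹ := by
    rw [Complex.finrank_real_complex, ha]
    push_cast
    apply le_of_eq
    field_simp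
    ring
  have ha3 : a < Module.finrank ℝ ℂ := by rw [Complex.finrank_real_complex]; exact ha2
  have hp2p : (p : ENNReal) ≤ ((2 * p : NNReal) : ENNReal) := by
    rw [ENNReal.coe_le_coe, two_mul]; exact le_self_add
  set C1 := eLpNormLESNormFDerivOfLeConst ℝ (volume : Measure ℂ) (ball 0 1) a (2 * p) with hC1
  set B : ENNReal := volume (ball (0:ℂ) 1) ^ (1 / (a:ENNReal).toReal - 1 / (2:ENNReal).toReal) with hB
  have hBt : B ≠ ⊤ := by
    apply ENNReal.rpow_ne_top_of_nonneg _ measure_ball_lt_top.ne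
    simp
    have : (a:ℝ) ≤ 2 := by exact_mod_cast ha2.le
    gcongr
  have key : ∀ v : ℂ → ℝ, IsT (ball 0 1) v → ∀ η : ℝ, 0 < η →
      eLpNorm v p (volume.restrict (ball 0 η)) ≤
        C1 * (B * eLpNorm (fderiv ℝ v) 2 volume) * volume (ball (0:ℂ) η) ^ (1 / (2 * p) : ℝ) := by
    intro v hv η hη
    have hvc : Continuous v := hv.smooth.continuous
    have hsm : ContDiff ℝ 1 v := hv.smooth.of_le (by exact_mod_cast le_top)
    have hdc : Continuous (fderiv ℝ v) := hsm.continuous_fderiv (by simp)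
    have h1 := eLpNorm_le_eLpNorm_mul_rpow_measure_univ (μ := volume.restrict (ball (0:ℂ) η))
      (p := (p:ENNReal)) (q := ((2 * p : NNReal) : ENNReal)) (f := v)
      hp2p hvc.aestronglyMeasurable
    have h2 := eLpNorm_le_eLpNorm_fderiv_of_le (μ := (volume : Measure ℂ)) (s := ball 0 1) (p := a)
      (q := 2 * p) hsm ((subset_tsupport v).trans hv.supp) ha1 ha3 hpq isBounded_ball
    have h3 : eLpNorm (fderiv ℝ v) a volume = eLpNorm (fderiv ℝ v) a (volume.restrict (ball 0 1)) := by
      rw [← eLpNorm_norm (fderiv ℝ v), ← eLpNorm_norm (fderiv ℝ v)]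
      have hs : Function.support (fun x => ‖fderiv ℝ v x‖) ⊆ ball 0 1 := by
        intro x hx
        refine hv.supp (support_fderiv_subset ℝ ?_)
        intro h; apply hx; simp [h]
      exact (eLpNorm_restrict_eq_of_support_subset (p := (a : ENNReal)) (μ := volume) hs).symm
    have h4 := eLpNorm_le_eLpNorm_mul_rpow_measure_univ (μ := volume.restrict (ball (0:ℂ) 1))
      (p := (a:ENNReal)) (q := 2) (f := fderiv ℝ v) (by exact_mod_cast ha2.le) hdc.aestronglyMeasurable
    have h5 : eLpNorm (fderiv ℝ v) 2 (volume.restrict (ball 0 1)) ≤ eLpNorm (fderiv ℝ v) 2 volume :=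
      eLpNorm_mono_measure _ Measure.restrict_le_self
    have h6 : eLpNorm v ((2 * p : NNReal) : ENNReal) (volume.restrict (ball 0 η)) ≤ eLpNorm v ((2 * p : NNReal) : ENNReal) volume :=
      eLpNorm_mono_measure _ Measure.restrict_le_self
    have e1 : (1 / (p:ENNReal).toReal - 1 / ((2 * p : NNReal) : ENNReal).toReal) = (1 / (2 * p) : ℝ) := by
      simp; field_simp; ring
    rw [e1] at h1
    simp only [Measure.restrict_apply_univ] at h1 h4
    rw [← hB] at h4
    refine h1.trans ?_
    gcongr
    refine h6.trans (h2.trans ?_)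
    rw [← hC1]
    gcongr
    rw [h3]
    refine h4.trans ?_
    rw [mul_comm]
    gcongr
  -- real version
  refine ⟨(C1 * B.toReal + 1) ^ (p:ℝ) * √π, by positivity, fun v hv η hη => ?_⟩
  have hvc : Continuous v := hv.smooth.continuous
  have hsm : ContDiff ℝ 1 v := hv.smooth.of_le (by exact_mod_cast le_top)
  have hdc : Continuous (fderiv ℝ v) := hsm.continuous_fderiv (by simp)
  have m1 : MemLp v p (volume.restrict (ball 0 η)) := (hvc.memLp_of_hasCompactSupport hv.cpt).restrict _
  have m2 : MemLp (fderiv ℝ v) 2 volume := hdc.memLp_of_hasCompactSupport (hv.cpt.fderiv ℝ)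
  have hk := key v hv η hη
  rw [m1.eLpNorm_eq_integral_rpow_norm (by exact_mod_cast hp0'.ne') (by simp),
    m2.eLpNorm_eq_integral_rpow_norm (by simp) (by simp)] at hk
  have hvol : volume (ball (0:ℂ) η) = ENNReal.ofReal (π * η ^ 2) := by
    rw [Complex.volume_ball, ENNReal.ofReal_mul pi_pos.le, mul_comm, ENNReal.ofReal_pow hη.le]
    congr 1
    simp [ENNReal.ofReal, NNReal.pi, Real.toNNReal_of_nonneg pi_pos.le]
    rfl
  rw [hvol, ← ENNReal.ofReal_toReal hBt, ENNReal.ofReal_rpow_of_nonneg (by positivity) (by positivity),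
    ← ENNReal.ofReal_mul (by positivity), ← ENNReal.ofReal_coe_nnreal (p := C1), ← ENNReal.ofReal_mul (by positivity),
    ← ENNReal.ofReal_mul (by positivity), ENNReal.ofReal_le_ofReal_iff (by positivity)] at hk
  simp only [ENNReal.coe_toReal, ENNReal.toReal_ofNat] at hk
  have hI : ∫ x in ball 0 η, v x ^ (p:ℝ) = ∫ x in ball 0 η, ‖v x‖ ^ (p:ℝ) := by
    congr 1; ext x; rw [Real.norm_of_nonneg (hv.nonneg x)]
  have hI0 : 0 ≤ ∫ x in ball 0 η, ‖v x‖ ^ (p:ℝ) := by positivity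
  have hD : ∫ x, ‖fderiv ℝ v x‖ ^ (2:ℝ) = ∫ x, ‖fderiv ℝ v x‖ ^ 2 := by simp
  rw [hD] at hk
  set D := ∫ x, ‖fderiv ℝ v x‖ ^ 2 with hDd
  have hD0 : 0 ≤ D := by positivity
  rw [hI]
  set I := ∫ x in ball 0 η, ‖v x‖ ^ (p:ℝ) with hId
  calc I = (I ^ ((p:ℝ)⁻¹)) ^ (p:ℝ) := by rw [← rpow_mul hI0, inv_mul_cancel₀ hp0.ne', rpow_one]
    _ ≤ (C1 * (B.toReal * D ^ (2:ℝ)⁻¹) * (π * η ^ 2) ^ (1 / (2 * p) : ℝ)) ^ (p:ℝ) := by gcongr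
    _ ≤ ((C1 * B.toReal + 1) * D ^ (2:ℝ)⁻¹ * (π * η ^ 2) ^ (1 / (2 * p) : ℝ)) ^ (p:ℝ) := by
        refine rpow_le_rpow (by positivity) ?_ hp0.le
        refine mul_le_mul_of_nonneg_right ?_ (by positivity)
        rw [← mul_assoc]
        exact mul_le_mul_of_nonneg_right (by linarith) (by positivity)
    _ = _ := by
        rw [mul_rpow (by positivity) (by positivity), mul_rpow (by positivity) (by positivity),
          ← rpow_mul hD0, ← rpow_mul (by positivity)]
        have : (1 / (2 * p) * p : ℝ) = 1 / 2 := by field_simp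
        rw [this, ← sqrt_eq_rpow, sqrt_mul pi_pos.le, sqrt_sq hη.le]
        have : ((2:ℝ)⁻¹ * p) = p / 2 := by ring
        rw [this]; ring

theorem aux_ker {R : ℝ} (hR : 1 < R) : ∃ K : ℝ → ℝ, Continuous K ∧ (∀ θ, 0 < K θ) ∧
    ∀ g : ℂ → ℂ, DiffContOnCl ℂ g (ball 0 R) →
      ∫ θ in (0:ℝ)..2 * π, (K θ : ℂ) * g (circleMap 0 R θ) = g 1 := by
  have hne : ∀ θ, circleMap 0 R θ - 1 ≠ 0 := by
    intro θ h
    have h2 : ‖circleMap 0 R θ‖ = 1 := by rw [sub_eq_zero.1 h]; simp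
    simp at h2
    rw [abs_of_pos (by linarith)] at h2
    linarith
  refine ⟨fun θ => (2 * π)⁻¹ * ((R ^ 2 - 1) / ‖circleMap 0 R θ - 1‖ ^ 2), ?_, ?_, ?_⟩
  · refine continuous_const.mul (continuous_const.div ?_ ?_)
    · exact ((continuous_circleMap 0 R).sub continuous_const).norm.pow 2
    · intro θ; have := hne θ; positivity
  · intro θ
    have := hne θ
    have : 0 < R ^ 2 - 1 := by nlinarith
    have := pi_pos
    have : 0 < ‖circleMap 0 R θ - 1‖ := by positivity
    positivity
  · intro g hg
    have h := hg.circleAverage_poissonKernel_smul (w := 1) (by simpa using hR)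
    rw [← h, Real.circleAverage_def, ← intervalIntegral.integral_smul]
    congr 1
    ext θ
    simp only [poissonKernel_def, Pi.smul_apply', sub_zero, norm_circleMap_zero, Complex.real_smul, norm_one, sq_abs]
    push_cast
    ring

theorem aux_quad {R : ℝ} (hR : 1 < R) {K : ℝ → ℝ} (hKc : Continuous K)
    (hK : ∀ g : ℂ → ℂ, DiffContOnCl ℂ g (ball 0 R) →
      ∫ θ in (0:ℝ)..2 * π, (K θ : ℂ) * g (circleMap 0 R θ) = g 1)
    {g : ℂ → ℂ} (hg : DiffContOnCl ℂ g (ball 0 R)) :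
    ∫ θ in (0:ℝ)..2 * π, K θ * ‖g (circleMap 0 R θ)‖ ^ 2 =
      ‖g 1‖ ^ 2 + ∫ θ in (0:ℝ)..2 * π, K θ * ‖g (circleMap 0 R θ) - g 1‖ ^ 2 := by
  have hc : Continuous fun θ => g (circleMap 0 R θ) := by
    refine hg.continuousOn.comp_continuous (continuous_circleMap 0 R) fun θ => ?_
    rw [closure_ball _ (by linarith)]
    simp [abs_of_pos (show 0 < R by linarith)]
  have h1 : ∫ θ in (0:ℝ)..2 * π, K θ = 1 := by
    have := hK (fun _ => 1) diffContOnCl_const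
    simp only [mul_one] at this
    rw [intervalIntegral.integral_ofReal] at this
    exact_mod_cast this
  have hKg := hK g hg
  obtain ⟨φ, hφ⟩ : ∃ φ : ℝ → ℂ, ∀ θ, g (circleMap 0 R θ) = φ θ := ⟨_, fun _ => rfl⟩
  simp only [hφ] at hc hKg ⊢
  have hc' : Continuous fun θ => ((starRingEnd ℂ) (g 1) * φ θ).re := Complex.continuous_re.comp (continuous_const.mul hc)
  have h2 : ∫ θ in (0:ℝ)..2 * π, K θ * (starRingEnd ℂ (g 1) * φ θ).re = ‖g 1‖ ^ 2 := by
    have h3 : ∫ θ in (0:ℝ)..2 * π, starRingEnd ℂ (g 1) * ((K θ : ℂ) * φ θ) = (‖g 1‖ ^ 2 : ℝ) := by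
      rw [intervalIntegral.integral_const_mul, hKg, mul_comm, Complex.mul_conj, Complex.normSq_eq_norm_sq]
    have h4 := Complex.reCLM.intervalIntegral_comp_comm (a := 0) (b := 2 * π) (μ := volume)
      (f := fun θ => starRingEnd ℂ (g 1) * ((K θ : ℂ) * φ θ))
      (Continuous.intervalIntegrable (by fun_prop) _ _)
    rw [h3] at h4
    simp only [Complex.reCLM_apply, Complex.ofReal_re] at h4
    rw [← h4]
    congr 1
    ext θ
    rw [← Complex.re_ofReal_mul]
    congr 1
    ring
  have h5 : ∀ θ, K θ * ‖φ θ - g 1‖ ^ 2 = K θ * ‖φ θ‖ ^ 2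
      - 2 * (K θ * (starRingEnd ℂ (g 1) * φ θ).re) + K θ * ‖g 1‖ ^ 2 := by
    intro θ
    rw [← Complex.normSq_eq_norm_sq, ← Complex.normSq_eq_norm_sq, ← Complex.normSq_eq_norm_sq, Complex.normSq_sub]
    rw [mul_comm (starRingEnd ℂ (g 1))]
    ring
  simp_rw [h5]
  rw [intervalIntegral.integral_add, intervalIntegral.integral_sub, intervalIntegral.integral_const_mul,
    intervalIntegral.integral_mul_const, h1, h2]
  · ring
  all_goals exact Continuous.intervalIntegrable (by fun_prop) _ _

theorem aux_avg {K : ℝ → ℝ} (hKc : Continuous K) (hK0 : ∀ θ, 0 < K θ)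
    (h1 : ∫ θ in (0:ℝ)..2 * π, K θ = 1) {w : ℂ → ℝ} (hw : Continuous w)
    (hwc : HasCompactSupport w) {W : ℝ → ℂ → ℝ} (hW : Continuous (Function.uncurry W)) :
    ∃ θ, ∫ z, w z * (∫ θ in (0:ℝ)..2 * π, K θ * W θ z) ≤ ∫ z, w z * W θ z := by
  set A := ∫ z, w z * (∫ θ in (0:ℝ)..2 * π, K θ * W θ z) with hA
  have hN : Continuous fun θ => ∫ z, w z * W θ z := by
    have : ∀ θ, ∫ z, w z * W θ z = ∫ z in tsupport w, w z * W θ z := fun θ =>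
      aux_setint (fun z hz => subset_tsupport w (fun h => hz (by simp [h])))
    simp_rw [this]
    refine continuous_parametric_integral_of_continuous (f := fun θ z => w z * W θ z) ?_ hwc.isCompact
    exact (hw.comp continuous_snd).mul hW
  have hsw : A = ∫ θ in (0:ℝ)..2 * π, K θ * ∫ z, w z * W θ z := by
    have e1 : A = ∫ z in tsupport w, ∫ θ in Ioc (0:ℝ) (2 * π), w z * (K θ * W θ z) := by
      rw [hA, aux_setint (U := tsupport w) (fun z hz => subset_tsupport w (fun h => hz (by simp [h])))]
      congr 1
      ext z
      rw [intervalIntegral.integral_of_le two_pi_pos.le, integral_const_mul]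
    have e2 : ∫ θ in (0:ℝ)..2 * π, K θ * ∫ z, w z * W θ z =
        ∫ θ in Ioc (0:ℝ) (2 * π), ∫ z in tsupport w, w z * (K θ * W θ z) := by
      rw [intervalIntegral.integral_of_le two_pi_pos.le]
      congr 1
      ext θ
      rw [← aux_setint (U := tsupport w) (fun z hz => subset_tsupport w (fun h => hz (by simp [h]))),
        ← integral_const_mul]
      congr 1
      ext z
      ring
    rw [e1, e2]
    refine integral_integral_swap ?_
    rw [Measure.prod_restrict]
    refine IntegrableOn.mono_set (t := tsupport w ×ˢ Icc 0 (2 * π)) ?_ (prod_mono le_rfl Ioc_subset_Icc_self)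
    refine ContinuousOn.integrableOn_compact (hwc.isCompact.prod isCompact_Icc) (Continuous.continuousOn ?_)
    have : Continuous fun q : ℂ × ℝ => W q.2 q.1 := hW.comp (continuous_snd.prodMk continuous_fst)
    simp only [Function.uncurry_def]
    fun_prop
  by_contra! hcon
  have hpos : 0 < ∫ θ in (0:ℝ)..2 * π, K θ * (A - ∫ z, w z * W θ z) := by
    refine intervalIntegral.intervalIntegral_pos_of_pos_on (Continuous.intervalIntegrable (by fun_prop) _ _) (fun θ _ => ?_) two_pi_pos
    exact mul_pos (hK0 θ) (sub_pos.2 (hcon θ))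
  simp_rw [mul_sub] at hpos
  rw [intervalIntegral.integral_sub (Continuous.intervalIntegrable (by fun_prop) _ _) (Continuous.intervalIntegrable (by fun_prop) _ _),
    intervalIntegral.integral_mul_const, h1, ← hsw] at hpos
  simp at hpos

theorem IsT.mono' {D D' : Set ℂ} {u : ℂ → ℝ} (h : IsT D u) (hD : D ⊆ D') : IsT D' u :=
  ⟨h.smooth, h.cpt, h.supp.trans hD, h.nonneg⟩

theorem aux_T1 {U : Set ℂ} (hU : IsOpen U) {f : ℂ → ℂ} (hf : DifferentiableOn ℂ f U)
    (hinj : InjOn f U) {p : ℝ} (hp : 1 ≤ p) {u : ℂ → ℝ} (hu : IsT (f '' U) u) :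
    ∃ v, IsT U v ∧ ∫ x, ‖fderiv ℝ u x‖ ^ 2 = ∫ x, ‖fderiv ℝ v x‖ ^ 2 ∧
      ∫ x, u x ^ p = ∫ x, v x ^ p * ‖deriv f x‖ ^ 2 := by
  obtain ⟨k, hk, -, hkd⟩ := aux_inv hU hf hinj
  have hv := aux_pull hU hf hkd.continuousOn hk hu
  have h : ∀ z ∈ U, U.indicator (u ∘ f) z = u (f z) := fun z hz => by simp [hz]
  exact ⟨_, hv, aux_E hU hf hinj hu hv h, aux_N hU hf hinj hu hv h hp⟩

theorem aux_T2 {U : Set ℂ} (hU : IsOpen U) {f : ℂ → ℂ} (hf : DifferentiableOn ℂ f U)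
    (hinj : InjOn f U) {p : ℝ} (hp : 1 ≤ p) {v : ℂ → ℝ} (hv : IsT U v) :
    ∃ u, IsT (f '' U) u ∧ ∫ x, ‖fderiv ℝ u x‖ ^ 2 = ∫ x, ‖fderiv ℝ v x‖ ^ 2 ∧
      ∫ x, u x ^ p = ∫ x, v x ^ p * ‖deriv f x‖ ^ 2 := by
  obtain ⟨k, hk, hV, hkd⟩ := aux_inv hU hf hinj
  have himg : k '' (f '' U) = U := by
    rw [image_image]
    ext z
    constructor
    · rintro ⟨y, hy, rfl⟩; simp only [hk y hy]; exact hy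
    · intro hz; exact ⟨z, hz, hk z hz⟩
  have hu : IsT (f '' U) ((f '' U).indicator (v ∘ k)) := by
    refine aux_pull hV hkd (k := f) (by rw [himg]; exact hf.continuousOn) ?_ (by rw [himg]; exact hv)
    rintro _ ⟨z, hz, rfl⟩
    rw [hk z hz]
  have h : ∀ z ∈ U, v z = (f '' U).indicator (v ∘ k) (f z) := fun z hz => by
    simp [mem_image_of_mem f hz, hk z hz]
  exact ⟨_, hu, aux_E hU hf hinj hu hv h, aux_N hU hf hinj hu hv h hp⟩

theorem aux_cpow {D : Set ℂ} {v : ℂ → ℝ} (hv : IsT D v) {p : ℝ} (hp : 1 ≤ p) :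
    Continuous (fun z => v z ^ p) ∧ HasCompactSupport (fun z => v z ^ p) := by
  have hp0 : p ≠ 0 := by positivity
  refine ⟨hv.smooth.continuous.rpow_const fun _ => Or.inr (by linarith), ?_⟩
  exact hv.cpt.comp_left (g := fun x : ℝ => x ^ p) (by simp [hp0])

theorem aux_lin {F : ℂ → ℂ} (hF : DifferentiableOn ℂ F (ball 0 1)) {R : ℝ} (hR : 1 < R) {ζ : ℂ}
    (hζ : ζ ≠ 0) (hg : DiffContOnCl ℂ (fun l : ℂ => F (l * ζ)) (ball 0 R))
    (h : ∀ l ∈ sphere (0:ℂ) R, F (l * ζ) = F ζ) : ∀ z ∈ ball (0:ℂ) 1, F z = F ζ := by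
  have h1 : EqOn (fun l : ℂ => F (l * ζ)) (fun _ => F ζ) (closure (ball 0 R)) := by
    refine Complex.eqOn_closure_of_eqOn_frontier isBounded_ball hg diffContOnCl_const ?_
    rw [frontier_ball _ (by linarith)]
    exact h
  have h2 : F =ᶠ[nhds 0] fun _ => F ζ := by
    have hpos : 0 < R * ‖ζ‖ := mul_pos (by linarith) (norm_pos_iff.2 hζ)
    filter_upwards [ball_mem_nhds (0:ℂ) hpos] with z hz
    have := h1 (x := z / ζ) (subset_closure (by
      rw [mem_ball_zero_iff] at hz ⊢
      rw [norm_div, div_lt_iff₀ (norm_pos_iff.2 hζ)]; exact hz))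
    simpa [div_mul_cancel₀ _ hζ] using this
  exact (hF.analyticOnNhd isOpen_ball).eqOn_of_preconnected_of_eventuallyEq
    (analyticOnNhd_const) (convex_ball _ _).isPreconnected (mem_ball_self one_pos) h2

theorem aux_disc {p : ℝ} (hp : 1 ≤ p) {f : ℂ → ℂ} (hf : DifferentiableOn ℂ f (ball 0 1))
    {r s : ℝ} (hr : 0 < r) (hrs : r < s) (hs : s < 1) :
    ∃ h : ℂ → ℝ, Continuous h ∧ (∀ z, 0 ≤ h z) ∧
      ((¬ ∃ a b : ℂ, ∀ z ∈ ball (0 : ℂ) 1, f z = a * z + b) → ∀ z ∈ closedBall (0:ℂ) r, z ≠ 0 → 0 < h z) ∧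
      ∀ v, IsT (ball 0 r) v → ∃ v', IsT (ball 0 s) v' ∧
        ∫ x, ‖fderiv ℝ v' x‖ ^ 2 = ∫ x, ‖fderiv ℝ v x‖ ^ 2 ∧
        (s / r) ^ 2 * ∫ x, v x ^ p * (‖deriv f x‖ ^ 2 + h x) ≤ ∫ x, v' x ^ p * ‖deriv f x‖ ^ 2 := by
  have hp0 : p ≠ 0 := by positivity
  obtain ⟨R, hRdef⟩ : ∃ R, R = s / r := ⟨_, rfl⟩
  have hRr : R * r = s := by rw [hRdef]; field_simp
  have hR : 1 < R := by rw [hRdef, one_lt_div hr]; exact hrs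
  rw [← hRdef]
  obtain ⟨K, hKc, hK0, hK⟩ := aux_ker hR
  have h1 : ∫ θ in (0:ℝ)..2 * π, K θ = 1 := by
    have := hK (fun _ => 1) diffContOnCl_const
    simp only [mul_one] at this
    rw [intervalIntegral.integral_ofReal] at this
    exact_mod_cast this
  have hF : DifferentiableOn ℂ (deriv f) (ball 0 1) := hf.deriv isOpen_ball
  have hsub : closedBall (0:ℂ) s ⊆ ball 0 1 := closedBall_subset_ball hs
  obtain ⟨G, hGc, hG⟩ : ∃ G : ℂ → ℂ, Continuous G ∧ ∀ z ∈ closedBall (0:ℂ) s, G z = deriv f z := by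
    obtain ⟨G, hG⟩ := ContinuousMap.exists_restrict_eq (isClosed_closedBall (x := (0:ℂ)) (ε := s))
      ⟨(closedBall (0:ℂ) s).domRestrict (deriv f), (hF.continuousOn.mono hsub).domRestrict⟩
    refine ⟨G, G.continuous, fun z hz => ?_⟩
    have := DFunLike.congr_fun hG ⟨z, hz⟩
    exact this
  have hmem : ∀ l ∈ closedBall (0:ℂ) R, ∀ z ∈ closedBall (0:ℂ) r, l * z ∈ closedBall (0:ℂ) s := by
    intro l hl z hz
    rw [mem_closedBall_zero_iff] at *
    rw [norm_mul, ← hRr]; gcongr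
  have hcm : ∀ θ, circleMap 0 R θ ∈ closedBall (0:ℂ) R := fun θ =>
    circleMap_mem_closedBall 0 (by linarith) θ
  have hzs : ∀ z ∈ closedBall (0:ℂ) r, z ∈ closedBall (0:ℂ) s := fun z hz => closedBall_subset_closedBall hrs.le hz
  have hdc : ∀ z ∈ closedBall (0:ℂ) r, DiffContOnCl ℂ (fun l : ℂ => deriv f (l * z)) (ball 0 R) := by
    intro z hz
    apply DifferentiableOn.diffContOnCl
    rw [closure_ball _ (by linarith)]
    exact hF.comp (by fun_prop) fun l hl => hsub (hmem l hl z hz)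
  have hcc : Continuous fun q : ℂ × ℝ => circleMap 0 R q.2 * q.1 :=
    ((continuous_circleMap 0 R).comp continuous_snd).mul continuous_fst
  have hGG : Continuous fun q : ℂ × ℝ => G (circleMap 0 R q.2 * q.1) := hGc.comp hcc
  have hquad : ∀ z ∈ closedBall (0:ℂ) r, ∫ θ in (0:ℝ)..2 * π, K θ * ‖G (circleMap 0 R θ * z)‖ ^ 2 =
      ‖deriv f z‖ ^ 2 + ∫ θ in (0:ℝ)..2 * π, K θ * ‖G (circleMap 0 R θ * z) - G z‖ ^ 2 := by
    intro z hz
    have := aux_quad hR hKc hK (hdc z hz)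
    simp only [one_mul] at this
    simp only [hG _ (hmem _ (hcm _) z hz), hG z (hzs z hz)]
    exact this
  refine ⟨fun z => ∫ θ in (0:ℝ)..2 * π, K θ * ‖G (circleMap 0 R θ * z) - G z‖ ^ 2, ?_, ?_, ?_, ?_⟩
  · refine intervalIntegral.continuous_parametric_intervalIntegral_of_continuous'
      (f := fun (z:ℂ) θ => K θ * ‖G (circleMap 0 R θ * z) - G z‖ ^ 2) ?_ _ _
    have : Continuous fun q : ℂ × ℝ => G q.1 := hGc.comp continuous_fst
    simp only [Function.uncurry_def]
    fun_prop
  · intro z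
    refine intervalIntegral.integral_nonneg two_pi_pos.le fun θ _ => ?_
    have := hK0 θ
    positivity
  · intro hnl z hz hz0
    refine intervalIntegral.integral_pos two_pi_pos ?_ (fun θ _ => ?_) ?_
    · have : Continuous fun θ : ℝ => G (circleMap 0 R θ * z) := hGc.comp ((continuous_circleMap 0 R).mul continuous_const)
      fun_prop
    · have := hK0 θ
      positivity
    · by_contra! hcon
      apply hnl
      have hconst := aux_lin hF hR hz0 (hdc z hz) (by
        intro l hl
        rw [← abs_of_pos (show 0 < R by linarith), ← image_circleMap_Ioc] at hl
        obtain ⟨θ, hθ, rfl⟩ := hl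
        have h2 := hcon θ (Ioc_subset_Icc_self hθ)
        have h3 : ‖G (circleMap 0 R θ * z) - G z‖ ^ 2 ≤ 0 := by
          by_contra! h4
          exact absurd (mul_pos (hK0 θ) h4) (not_lt.2 h2)
        have h4 : G (circleMap 0 R θ * z) - G z = 0 := by
          rw [← norm_eq_zero]; exact pow_eq_zero_iff (two_ne_zero) |>.1 (le_antisymm h3 (by positivity))
        rw [hG _ (hmem _ (hcm _) z hz), hG z (hzs z hz), sub_eq_zero] at h4
        exact h4)
      refine ⟨deriv f z, f 0, fun w hw => ?_⟩
      have h5 := (convex_ball (0:ℂ) 1).is_const_of_fderivWithin_eq_zero (𝕜 := ℂ)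
        (f := fun w => f w - deriv f z * w) (hf.sub (by fun_prop)) (fun y hy => ?_) hw (mem_ball_self one_pos)
      · simp only [mul_zero, sub_zero] at h5
        rw [← h5]; ring
      · rw [fderivWithin_of_isOpen isOpen_ball hy]
        ext
        have hd := (hf.differentiableAt (isOpen_ball.mem_nhds hy)).hasDerivAt.sub ((hasDerivAt_id y).const_mul (deriv f z))
        have hd' : HasDerivAt (fun w => f w - deriv f z * w) 0 y := by
          rw [hconst y hy, mul_one, sub_self] at hd
          exact hd
        rw [fderiv_apply_one_eq_deriv, hd'.deriv]
        simp
  · intro v hv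
    obtain ⟨hwc, hws⟩ := aux_cpow hv hp
    have hvz : ∀ z, z ∉ ball (0:ℂ) r → v z = 0 := fun z hz => by
      by_contra h; exact hz (hv.supp (subset_tsupport v h))
    obtain ⟨θ, hθ⟩ := aux_avg hKc hK0 h1 hwc hws (W := fun θ z => ‖G (circleMap 0 R θ * z)‖ ^ 2) (by
      simp only [Function.uncurry_def]
      exact (hGG.comp (continuous_snd.prodMk continuous_fst)).norm.pow 2)
    obtain ⟨l, hl⟩ : ∃ l, l = circleMap 0 R θ := ⟨_, rfl⟩
    rw [← hl] at hθ
    have hlR : ‖l‖ = R := by rw [hl]; simp; linarith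
    have hl0 : l ≠ 0 := by rw [← norm_pos_iff, hlR]; linarith
    have hlb : ∀ z, l * z ∈ ball (0:ℂ) s ↔ z ∈ ball (0:ℂ) r := by
      intro z
      rw [mem_ball_zero_iff, mem_ball_zero_iff, norm_mul, hlR, ← hRr]
      exact mul_lt_mul_iff_right₀ (by linarith)
    have hv2 : IsT ((fun z => l⁻¹ * z) '' ball (0:ℂ) s) v := hv.mono' fun z hz =>
      ⟨l * z, (hlb z).2 hz, by simp [hl0]⟩
    have hgd : DifferentiableOn ℂ (fun z => l⁻¹ * z) (ball (0:ℂ) s) := by fun_prop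
    have hinj : InjOn (fun z => l⁻¹ * z) (ball (0:ℂ) s) := fun a _ b _ hab => by
      simpa [hl0] using hab
    have hv' := aux_pull isOpen_ball hgd (k := fun z => l * z) (by fun_prop) (fun z _ => by simp [hl0]) hv2
    refine ⟨_, hv', (aux_E isOpen_ball hgd hinj hv2 hv' fun z hz => by simp only [indicator_of_mem hz, Function.comp]).symm, ?_⟩
    set v' := (ball (0:ℂ) s).indicator (v ∘ fun z => l⁻¹ * z) with hv'd
    have hvl : ∀ z, v' (l * z) = v z := by
      intro z
      by_cases hz : z ∈ ball (0:ℂ) r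
      · rw [hv'd, indicator_of_mem ((hlb z).2 hz)]; simp [hl0]
      · rw [hv'd, indicator_of_notMem (fun h => hz ((hlb z).1 h)), hvz z hz]
    have hcov := aux_cov isOpen_univ (f := fun z => l * z) (by fun_prop) (fun a _ b _ hab => by
      simpa [hl0] using hab) (fun z => v' z ^ p * ‖deriv f z‖ ^ 2)
    have himg : (fun z => l * z) '' univ = univ := by
      ext z; simp only [image_univ, mem_range, mem_univ, iff_true]; exact ⟨l⁻¹ * z, by simp [hl0]⟩
    have hder : ∀ z, deriv (fun z => l * z) z = l := fun z => by simp
    rw [himg] at hcov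
    simp only [Measure.restrict_univ, hder, hvl, hlR] at hcov
    rw [hcov, integral_const_mul]
    refine mul_le_mul_of_nonneg_left ?_ (by positivity)
    have e1 : ∫ z, v z ^ p * ‖deriv f (l * z)‖ ^ 2 = ∫ z, v z ^ p * ‖G (l * z)‖ ^ 2 := by
      congr 1; ext z
      by_cases hz : z ∈ ball (0:ℂ) r
      · rw [hG _ (ball_subset_closedBall ((hlb z).2 hz))]
      · rw [hvz z hz]; simp [hp0]
    rw [e1]
    refine le_trans (le_of_eq ?_) hθ
    congr 1; ext z
    by_cases hz : z ∈ ball (0:ℂ) r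
    · rw [hquad z (ball_subset_closedBall hz)]
    · rw [hvz z hz]; simp [hp0]
theorem Cp_eq (p : ℝ) (D : Set ℂ) : Cp p D = sInf { c : ℝ | ∃ u : ℂ → ℝ, IsT D u ∧ u ≠ 0 ∧
    c = (∫ x : ℂ, ‖fderiv ℝ u x‖ ^ 2) / (∫ x : ℂ, u x ^ p) ^ (2 / p) } := by
  unfold Cp
  congr 1
  ext c
  constructor
  · rintro ⟨u, h1, h2, h3, h4, h5, h6⟩
    exact ⟨u, ⟨h1, h2, h3, h4⟩, h5, h6⟩
  · rintro ⟨u, ⟨h1, h2, h3, h4⟩, h5, h6⟩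
    exact ⟨u, h1, h2, h3, h4, h5, h6⟩

theorem aux_pos {D : Set ℂ} {u : ℂ → ℝ} (hu : IsT D u) (h0 : u ≠ 0) {p : ℝ} (hp : 1 ≤ p) :
    0 < ∫ x, u x ^ p := by
  obtain ⟨hc, hs⟩ := aux_cpow hu hp
  obtain ⟨x, hx⟩ := Function.ne_iff.1 h0
  refine hc.integral_pos_of_hasCompactSupport_nonneg_nonzero hs (fun z => rpow_nonneg (hu.nonneg z) _) (x := x) ?_
  exact (rpow_pos_of_pos (lt_of_le_of_ne (hu.nonneg x) (Ne.symm hx)) _).ne'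

theorem aux_nonempty {D : Set ℂ} (hD : IsOpen D) (hne : D.Nonempty) (p : ℝ) :
    { c : ℝ | ∃ u : ℂ → ℝ, IsT D u ∧ u ≠ 0 ∧
    c = (∫ x : ℂ, ‖fderiv ℝ u x‖ ^ 2) / (∫ x : ℂ, u x ^ p) ^ (2 / p) }.Nonempty := by
  obtain ⟨x, hx⟩ := hne
  obtain ⟨u, h1, h2, h3, h4, h5⟩ := exists_contDiff_tsupport_subset (n := (⊤ : ℕ∞)) (hD.mem_nhds hx)
  refine ⟨_, u, ⟨h3, h2, h1, fun y => (h4 ⟨y, rfl⟩).1⟩, ?_, rfl⟩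
  intro h
  rw [h] at h5
  simp at h5

theorem aux_fin {p : ℝ} (hp : 1 ≤ p) {D D' : Set ℂ} (hD : IsOpen D) (hne : D.Nonempty)
    {κ M : ℝ} (hκ : 0 < κ) (hM : Cp p D < M)
    (H : ∀ u, IsT D u → u ≠ 0 →
      (∫ x : ℂ, ‖fderiv ℝ u x‖ ^ 2) / (∫ x : ℂ, u x ^ p) ^ (2 / p) < M →
      ∃ u', IsT D' u' ∧ ∫ x, ‖fderiv ℝ u' x‖ ^ 2 = ∫ x, ‖fderiv ℝ u x‖ ^ 2 ∧
        κ * ∫ x, u x ^ p ≤ ∫ x, u' x ^ p) :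
    κ ^ (2 / p) * Cp p D' ≤ Cp p D := by
  have hp0 : p ≠ 0 := by positivity
  by_contra! hcon
  obtain ⟨c, ⟨u, hu, hu0, rfl⟩, hc⟩ := exists_lt_of_csInf_lt (aux_nonempty hD hne p)
    (by rw [← Cp_eq]; exact lt_min hM hcon)
  obtain ⟨u', hu', hE, hN⟩ := H u hu hu0 (hc.trans_le (min_le_left _ _))
  have hNpos := aux_pos hu hu0 hp
  have hN'pos : 0 < ∫ x, u' x ^ p := lt_of_lt_of_le (by positivity) hN
  have hu'0 : u' ≠ 0 := by
    rintro rfl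
    simp [hp0] at hN'pos
  have h1 : Cp p D' ≤ (∫ x : ℂ, ‖fderiv ℝ u' x‖ ^ 2) / (∫ x : ℂ, u' x ^ p) ^ (2 / p) := by
    rw [Cp_eq]
    refine csInf_le ⟨0, ?_⟩ ⟨u', hu', hu'0, rfl⟩
    rintro _ ⟨w, hw, hw0, rfl⟩
    have := aux_pos hw hw0 hp
    positivity
  have h2 := hc.trans_le (min_le_right _ _)
  rw [hE] at h1
  refine absurd h2 (not_lt.2 ?_)
  calc _ ≤ κ ^ (2 / p) * ((∫ x : ℂ, ‖fderiv ℝ u x‖ ^ 2) / (∫ x : ℂ, u' x ^ p) ^ (2 / p)) := by gcongr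
    _ ≤ κ ^ (2 / p) * ((∫ x : ℂ, ‖fderiv ℝ u x‖ ^ 2) / (κ * ∫ x : ℂ, u x ^ p) ^ (2 / p)) := by gcongr
    _ = _ := by
      rw [mul_rpow hκ.le hNpos.le]
      have := rpow_pos_of_pos hκ (2 / p)
      have := rpow_pos_of_pos hNpos (2 / p)
      field_simp

theorem aux_strict {p : ℝ} (hp : 1 ≤ p) {f : ℂ → ℂ} (hf : DifferentiableOn ℂ f (ball 0 1))
    (hinj : InjOn f (ball 0 1)) {r : ℝ} (hr : 0 < r) (hr1 : r < 1) {h : ℂ → ℝ} (hh : Continuous h)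
    (hh0 : ∀ z, 0 ≤ h z) (hpos : ∀ z ∈ closedBall (0:ℂ) r, z ≠ 0 → 0 < h z) :
    0 < Cp p (f '' ball 0 r) ∧ ∀ M : ℝ, 0 < M → ∃ δ : ℝ, 0 < δ ∧ ∀ v, IsT (ball 0 r) v →
      (∫ x : ℂ, ‖fderiv ℝ v x‖ ^ 2) / (∫ x : ℂ, v x ^ p * ‖deriv f x‖ ^ 2) ^ (2 / p) < M →
      0 < (∫ x : ℂ, v x ^ p * ‖deriv f x‖ ^ 2) →
      δ * (∫ x : ℂ, v x ^ p * ‖deriv f x‖ ^ 2) ≤ ∫ x : ℂ, v x ^ p * h x := by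
  have hp0 : 0 < p := by linarith
  obtain ⟨S, hS, hSob⟩ := aux_sob hp
  have hF : DifferentiableOn ℂ (deriv f) (ball 0 1) := hf.deriv isOpen_ball
  have hFc : ContinuousOn (deriv f) (closedBall 0 r) := hF.continuousOn.mono (closedBall_subset_ball hr1)
  obtain ⟨K0, hK0, hK⟩ : ∃ K0 : ℝ, 0 < K0 ∧ ∀ z ∈ closedBall (0:ℂ) r, ‖deriv f z‖ ^ 2 ≤ K0 := by
    obtain ⟨C, hC⟩ := (isCompact_closedBall (0:ℂ) r).exists_bound_of_continuousOn (hFc.norm.pow 2)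
    refine ⟨max C 1, by positivity, fun z hz => le_max_of_le_left ?_⟩
    have := hC z hz
    simpa using this
  have hsub : ball (0:ℂ) r ⊆ ball 0 1 := ball_subset_ball hr1.le
  have hvz : ∀ v, IsT (ball 0 r) v → ∀ z, z ∉ ball (0:ℂ) r → v z ^ p = 0 := fun v hv z hz => by
    have : v z = 0 := by by_contra h; exact hz (hv.supp (subset_tsupport v h))
    rw [this, zero_rpow hp0.ne']
  have hint : ∀ v, IsT (ball 0 r) v → Integrable fun x => v x ^ p := fun v hv =>
    (aux_cpow hv hp).1.integrable_of_hasCompactSupport (aux_cpow hv hp).2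
  have hNI : ∀ v, IsT (ball 0 r) v → ∫ x, v x ^ p * ‖deriv f x‖ ^ 2 ≤ K0 * ∫ x, v x ^ p := by
    intro v hv
    rw [← integral_const_mul]
    refine integral_mono_of_nonneg (Filter.Eventually.of_forall fun x => ?_) ((hint v hv).const_mul _)
      (Filter.Eventually.of_forall fun x => ?_)
    · have := rpow_nonneg (hv.nonneg x) p
      positivity
    · by_cases hx : x ∈ ball (0:ℂ) r
      · have := hK x (ball_subset_closedBall hx)
        have h2 := rpow_nonneg (hv.nonneg x) p
        simp only
        rw [mul_comm K0]; gcongr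
      · simp [hvz v hv x hx]
  have hEN : ∀ v, IsT (ball 0 r) v → ∫ x, v x ^ p * ‖deriv f x‖ ^ 2 ≤
      K0 * S * r * (∫ x, ‖fderiv ℝ v x‖ ^ 2) ^ (p / 2) := by
    intro v hv
    have h1 := hSob v (hv.mono' hsub) r hr
    rw [setIntegral_eq_integral_of_forall_compl_eq_zero (hvz v hv)] at h1
    calc _ ≤ _ := hNI v hv
      _ ≤ K0 * (S * r * (∫ x, ‖fderiv ℝ v x‖ ^ 2) ^ (p / 2)) := by gcongr
      _ = _ := by ring
  constructor
  · have hc0 : 0 < ((K0 * S * r) ^ (2 / p))⁻¹ := by positivity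
    refine hc0.trans_le ?_
    rw [Cp_eq]
    have hop : IsOpen (f '' ball 0 r) :=
      (aux_inv isOpen_ball (hf.mono hsub) (hinj.mono hsub)).choose_spec.2.1
    refine le_csInf (aux_nonempty hop ((nonempty_ball.2 hr).image f) p) ?_
    rintro _ ⟨u, hu, hu0, rfl⟩
    obtain ⟨v, hv, hE, hN⟩ := aux_T1 isOpen_ball (hf.mono hsub) (hinj.mono hsub) hp hu
    have hNpos := aux_pos hu hu0 hp
    have := hEN v hv
    rw [← hE, ← hN] at this
    set E := ∫ x, ‖fderiv ℝ u x‖ ^ 2 with hEdef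
    have hE0 : 0 ≤ E := by positivity
    rw [le_div_iff₀ (by positivity), inv_mul_le_iff₀ (by positivity)]
    calc _ ≤ (K0 * S * r * E ^ (p / 2)) ^ (2 / p) := by gcongr
      _ = _ := by
        rw [mul_rpow (by positivity) (by positivity), ← rpow_mul hE0]
        have : p / 2 * (2 / p) = 1 := by field_simp
        rw [this, rpow_one]
  · intro M hM
    obtain ⟨η, hη, hηM⟩ : ∃ η : ℝ, 0 < η ∧ S * η * (M ^ (p / 2) * K0) ≤ 1 / 2 := by
      refine ⟨1 / (2 * (S * (M ^ (p / 2) * K0))), by positivity, le_of_eq ?_⟩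
      have := rpow_pos_of_pos hM (p / 2)
      field_simp
    obtain ⟨c, hc, hch⟩ := ((isCompact_closedBall (0:ℂ) r).diff (isOpen_ball : IsOpen (ball (0:ℂ) η))).exists_forall_le'
      hh.continuousOn (a := 0) (fun z hz => hpos z hz.1 (fun h0 => hz.2 (by rw [h0]; exact mem_ball_self hη)))
    refine ⟨c / (2 * K0), by positivity, fun v hv hQ hNpos => ?_⟩
    have h1 := hSob v (hv.mono' hsub) η hη
    have h2 := hNI v hv
    set N := ∫ x, v x ^ p * ‖deriv f x‖ ^ 2 with hNdef
    set E := ∫ x, ‖fderiv ℝ v x‖ ^ 2 with hEdef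
    set I := ∫ x, v x ^ p with hIdef
    have hE0 : 0 ≤ E := by positivity
    rw [div_lt_iff₀ (by positivity)] at hQ
    have h3 : E ^ (p / 2) ≤ M ^ (p / 2) * N := by
      calc _ ≤ (M * N ^ (2 / p)) ^ (p / 2) := by gcongr
        _ = _ := by
          rw [mul_rpow (by positivity) (by positivity), ← rpow_mul hNpos.le]
          have : 2 / p * (p / 2) = 1 := by field_simp
          rw [this, rpow_one]
    have hI0 : 0 < I := by
      by_contra! hI
      have : K0 * I ≤ 0 := mul_nonpos_of_nonneg_of_nonpos hK0.le hI
      linarith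
    have h4 : ∫ x in ball 0 η, v x ^ p ≤ I / 2 := by
      have hMp := rpow_pos_of_pos hM (p / 2)
      calc _ ≤ S * η * E ^ (p / 2) := h1
        _ ≤ S * η * (M ^ (p / 2) * (K0 * I)) := by
          gcongr
          exact h3.trans (by gcongr)
        _ = S * η * (M ^ (p / 2) * K0) * I := by ring
        _ ≤ 1 / 2 * I := by gcongr
        _ = _ := by ring
    have hint2 : Integrable fun x => v x ^ p * h x :=
      ((aux_cpow hv hp).1.mul hh).integrable_of_hasCompactSupport ((aux_cpow hv hp).2.mul_right)
    have h5 : c * (I - ∫ x in ball 0 η, v x ^ p) ≤ ∫ x, v x ^ p * h x := by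
      rw [← integral_indicator measurableSet_ball, hIdef, ← integral_sub (hint v hv)
        ((hint v hv).indicator measurableSet_ball), ← integral_const_mul]
      refine integral_mono (((hint v hv).sub ((hint v hv).indicator measurableSet_ball)).const_mul c) hint2 fun x => ?_
      have hvx := rpow_nonneg (hv.nonneg x) p
      simp only
      by_cases hx : x ∈ ball (0:ℂ) η
      · rw [indicator_of_mem hx, sub_self, mul_zero]
        exact mul_nonneg hvx (hh0 x)
      · rw [indicator_of_notMem hx, sub_zero]
        by_cases hxr : x ∈ ball (0:ℂ) r
        · have := hch x ⟨ball_subset_closedBall hxr, hx⟩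
          rw [mul_comm]; gcongr
        · simp [hvz v hv x hxr]
    calc c / (2 * K0) * N ≤ c / (2 * K0) * (K0 * I) := by gcongr
      _ = c * (I - I / 2) := by field_simp; ring
      _ ≤ c * (I - ∫ x in ball 0 η, v x ^ p) := by gcongr
      _ ≤ _ := h5

theorem aux_main {p : ℝ} (hp : 1 ≤ p) {f : ℂ → ℂ} (hf : DifferentiableOn ℂ f (ball 0 1))
    (hinj : InjOn f (ball 0 1)) {r s : ℝ} (hr : 0 < r) (hrs : r < s) (hs : s < 1) :
    s ^ (4 / p) * Cp p (f '' ball 0 s) ≤ r ^ (4 / p) * Cp p (f '' ball 0 r) ∧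
    ((¬ ∃ a b : ℂ, ∀ z ∈ ball (0 : ℂ) 1, f z = a * z + b) →
      s ^ (4 / p) * Cp p (f '' ball 0 s) < r ^ (4 / p) * Cp p (f '' ball 0 r)) := by
  have hp0 : 0 < p := by linarith
  have hs0 : 0 < s := hr.trans hrs
  have hsubr : ball (0:ℂ) r ⊆ ball 0 1 := ball_subset_ball (hrs.trans hs).le
  have hsubs : ball (0:ℂ) s ⊆ ball 0 1 := ball_subset_ball hs.le
  have hop : IsOpen (f '' ball 0 r) :=
    (aux_inv isOpen_ball (hf.mono hsubr) (hinj.mono hsubr)).choose_spec.2.1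
  have hne : (f '' ball 0 r).Nonempty := (nonempty_ball.2 hr).image f
  obtain ⟨h, hh, hh0, hhpos, hd⟩ := aux_disc hp hf hr hrs hs
  have hFc : ContinuousOn (deriv f) (closedBall 0 r) :=
    (hf.deriv isOpen_ball).continuousOn.mono (closedBall_subset_ball (hrs.trans hs))
  -- transfer
  have tr : ∀ u, IsT (f '' ball 0 r) u → ∃ v u', IsT (ball 0 r) v ∧ IsT (f '' ball 0 s) u' ∧
      ∫ x, ‖fderiv ℝ u x‖ ^ 2 = ∫ x, ‖fderiv ℝ v x‖ ^ 2 ∧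
      ∫ x, u x ^ p = ∫ x, v x ^ p * ‖deriv f x‖ ^ 2 ∧
      ∫ x, ‖fderiv ℝ u' x‖ ^ 2 = ∫ x, ‖fderiv ℝ u x‖ ^ 2 ∧
      (s / r) ^ 2 * ((∫ x, u x ^ p) + ∫ x, v x ^ p * h x) ≤ ∫ x, u' x ^ p := by
    intro u hu
    obtain ⟨v, hv, hE, hN⟩ := aux_T1 isOpen_ball (hf.mono hsubr) (hinj.mono hsubr) hp hu
    obtain ⟨v', hv', hE', hN'⟩ := hd v hv
    obtain ⟨u', hu', hE2, hN2⟩ := aux_T2 isOpen_ball (hf.mono hsubs) (hinj.mono hsubs) hp hv'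
    refine ⟨v, u', hv, hu', hE, hN, by rw [hE2, hE', hE], ?_⟩
    rw [hN2, hN]
    refine le_trans (le_of_eq ?_) hN'
    congr 1
    obtain ⟨hc, hcs⟩ := aux_cpow hv hp
    rw [← integral_add]
    · congr 1; ext x; ring
    · have hcont : ContinuousOn (fun x => v x ^ p * ‖deriv f x‖ ^ 2) (closedBall 0 r) :=
        hc.continuousOn.mul (hFc.norm.pow 2)
      refine (integrableOn_iff_integrable_of_support_subset ?_).1
        (hcont.integrableOn_compact (isCompact_closedBall _ _))
      intro x hx
      apply ball_subset_closedBall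
      apply hv.supp
      apply subset_tsupport
      intro h0; apply hx; simp [h0, hp0.ne']
    · exact (hc.mul hh).integrable_of_hasCompactSupport hcs.mul_right
  have hsr : 0 < s / r := by positivity
  have hfac : s ^ (4 / p) = r ^ (4 / p) * ((s / r) ^ 2) ^ (2 / p) := by
    rw [← rpow_natCast, ← rpow_mul hsr.le]
    have : ((2:ℕ):ℝ) * (2 / p) = 4 / p := by push_cast; ring
    rw [this, ← mul_rpow hr.le hsr.le]
    congr 1; field_simp
  have hr4 : 0 < r ^ (4 / p) := by positivity
  constructor
  · have := aux_fin hp (D' := f '' ball 0 s) hop hne (κ := (s / r) ^ 2) (by positivity) (lt_add_one (Cp p (f '' ball 0 r)))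
      (fun u hu hu0 _ => by
        obtain ⟨v, u', hv, hu', -, -, hE, hN⟩ := tr u hu
        refine ⟨u', hu', hE, le_trans ?_ hN⟩
        have : 0 ≤ ∫ x, v x ^ p * h x := integral_nonneg fun x => mul_nonneg (rpow_nonneg (hv.nonneg x) _) (hh0 x)
        gcongr; linarith)
    rw [hfac, mul_assoc]
    gcongr
  · intro hnl
    obtain ⟨hCpos, hst⟩ := aux_strict hp hf hinj hr (hrs.trans hs) hh hh0 (hhpos hnl)
    obtain ⟨δ, hδ, H⟩ := hst (2 * Cp p (f '' ball 0 r)) (by positivity)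
    have := aux_fin hp (D' := f '' ball 0 s) hop hne (κ := (s / r) ^ 2 * (1 + δ)) (by positivity)
      (show Cp p (f '' ball 0 r) < 2 * Cp p (f '' ball 0 r) by linarith)
      (fun u hu hu0 hQ => by
        obtain ⟨v, u', hv, hu', hE1, hN1, hE, hN⟩ := tr u hu
        refine ⟨u', hu', hE, le_trans ?_ hN⟩
        have hNpos := aux_pos hu hu0 hp
        have h3 := H v hv (by rw [← hE1, ← hN1]; exact hQ) (by rw [← hN1]; exact hNpos)
        rw [← hN1] at h3
        rw [mul_assoc]
        gcongr
        linarith)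
    rw [mul_rpow (by positivity) (by positivity)] at this
    rw [hfac, mul_assoc]
    refine mul_lt_mul_of_pos_left ?_ hr4
    set X := ((s / r) ^ 2) ^ (2 / p) * Cp p (f '' ball 0 s) with hX
    have hk : 1 < (1 + δ) ^ (2 / p) := one_lt_rpow (by linarith) (by positivity)
    have h6 : (1 + δ) ^ (2 / p) * X ≤ Cp p (f '' ball 0 r) := by
      refine le_trans (le_of_eq ?_) this
      rw [hX]; ring
    by_contra! h7
    have : 0 < X := hCpos.trans_le h7
    nlinarith

/-- Schwarz Lemma for the Sobolev constant: for a conformal map `f` of the unit disk,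
`r ↦ r^{4/p} C_p(f(r𝔻))` is nonincreasing on `(0,1)`, and strictly decreasing unless
`f` is linear. -/
theorem Cp_schwarz_monotone (p : ℝ) (hp : 1 ≤ p) (f : ℂ → ℂ)
    (hf : DifferentiableOn ℂ f (ball 0 1)) (hinj : Set.InjOn f (ball 0 1)) :
    AntitoneOn (fun r : ℝ => r ^ (4 / p) * Cp p (f '' ball 0 r)) (Set.Ioo 0 1) ∧
      (¬ (∃ a b : ℂ, ∀ z ∈ ball (0 : ℂ) 1, f z = a * z + b) →
        StrictAntiOn (fun r : ℝ => r ^ (4 / p) * Cp p (f '' ball 0 r)) (Set.Ioo 0 1)) := by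
  refine ⟨fun r hr s hs hrs => ?_, fun hnl r hr s hs hrs => (aux_main hp hf hinj hr.1 hrs hs.2).2 hnl⟩
  rcases hrs.eq_or_lt with rfl | hlt
  · exact le_rfl
  · exact (aux_main hp hf hinj hr.1 hlt hs.2).1
end

section
/- Let f be a conformal map of the unit disk and p ≥ 1. For ζ ∈ 𝔻 define Ω_ζ = g_ζ(𝔻) where g_ζ(z) = f(ζz)/ζ, and Ψ(ζ) = 1/C_p(Ω_ζ). Then Ψ^{p/2} is subharmonic on 𝔻, and is strictly subharmonic unless f is linear. -/
open MeasureTheory Metric Set Real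

/-- The domain `Ω_ζ = g_ζ(𝔻)` where `g_ζ(z) = f(ζz)/ζ` (and `g_0(z) = f'(0) z`). -/
noncomputable def OmegaZ (f : ℂ → ℂ) (ζ : ℂ) : Set ℂ :=
  if ζ = 0 then (fun z => deriv f 0 * z) '' ball 0 1
  else (fun z => f (ζ * z) / ζ) '' ball 0 1

/-- `Ψ(ζ) = 1 / C_p(Ω_ζ)`. -/
noncomputable def Psi (f : ℂ → ℂ) (p : ℝ) (ζ : ℂ) : ℝ := 1 / Cp p (OmegaZ f ζ)

/-- Test functions on `D`. -/
def TF (D : Set ℂ) (u : ℂ → ℝ) : Prop :=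
  ContDiff ℝ (⊤ : ℕ∞) u ∧ HasCompactSupport u ∧ tsupport u ⊆ D ∧ (∀ x, 0 ≤ u x) ∧ u ≠ 0

/-- Dirichlet integral. -/
noncomputable def Dir (u : ℂ → ℝ) : ℝ := ∫ x : ℂ, ‖fderiv ℝ u x‖ ^ 2

open Filter Topology in
theorem inv_lemma {g : ℂ → ℂ} (hg : DifferentiableOn ℂ g (ball 0 1))
    (hinj : InjOn g (ball 0 1)) :
    IsOpen (g '' ball 0 1) ∧ (∀ z ∈ ball (0:ℂ) 1, deriv g z ≠ 0) ∧
    ∃ h : ℂ → ℂ, DifferentiableOn ℂ h (g '' ball 0 1) ∧ ∀ z ∈ ball (0:ℂ) 1, h (g z) = z := by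
  have hU : IsOpen (ball (0:ℂ) 1) := isOpen_ball
  have han : AnalyticOnNhd ℂ g (ball 0 1) := hg.analyticOnNhd hU
  have hpre : IsPreconnected (ball (0:ℂ) 1) := (convex_ball 0 1).isPreconnected
  have hopen : ∀ s ⊆ ball (0:ℂ) 1, IsOpen s → IsOpen (g '' s) := by
    rcases han.is_constant_or_isOpen hpre with ⟨w, hw⟩ | h
    · exfalso
      have h0 : (0:ℂ) ∈ ball (0:ℂ) 1 := by simp
      have h1 : (1/2:ℂ) ∈ ball (0:ℂ) 1 := by simp; norm_num
      have := hinj h0 h1 (by rw [hw _ h0, hw _ h1])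
      norm_num at this
    · exact h
  have hO := hopen _ subset_rfl hU
  set h := Function.invFunOn g (ball 0 1) with hh
  have hleft : ∀ z ∈ ball (0:ℂ) 1, h (g z) = z := fun z hz => hinj.leftInvOn_invFunOn hz
  have hcont : ∀ z ∈ ball (0:ℂ) 1, ContinuousAt h (g z) := by
    intro z hz
    rw [ContinuousAt, hleft z hz, tendsto_def]
    intro s hs
    obtain ⟨t, hts, hto, hzt⟩ := _root_.mem_nhds_iff.1 hs
    have : g '' (t ∩ ball 0 1) ∈ 𝓝 (g z) :=
      (hopen _ inter_subset_right (hto.inter hU)).mem_nhds ⟨z, ⟨hzt, hz⟩, rfl⟩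
    filter_upwards [this]
    rintro _ ⟨y, hy, rfl⟩
    show h (g y) ∈ s
    rw [hleft y hy.2]; exact hts hy.1
  have hright : ∀ y ∈ g '' ball 0 1, g (h y) = y := by
    rintro _ ⟨z, hz, rfl⟩; rw [hleft z hz]
  have hd1 : ∀ z ∈ ball (0:ℂ) 1, deriv g z ≠ 0 → DifferentiableAt ℂ h (g z) := by
    intro z hz hz'
    have hd : HasDerivAt g (deriv g z) (h (g z)) := by
      rw [hleft z hz]; exact (hg.differentiableAt (hU.mem_nhds hz)).hasDerivAt
    refine (HasDerivAt.of_local_left_inverse (hcont z hz) hd hz' ?_).differentiableAt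
    filter_upwards [hO.mem_nhds ⟨z, hz, rfl⟩] with y hy using hright y hy
  have hd2 : ∀ z ∈ ball (0:ℂ) 1, DifferentiableAt ℂ h (g z) := by
    intro z hz
    refine (Complex.analyticAt_of_differentiable_on_punctured_nhds_of_continuousAt ?_
      (hcont z hz)).differentiableAt
    have hne : ∀ᶠ x in 𝓝[≠] z, deriv g x ≠ 0 := by
      rcases (han.deriv z hz).eventually_eq_zero_or_eventually_ne_zero with h0 | h0
      · exfalso
        obtain ⟨r, hr, hball⟩ := Metric.eventually_nhds_iff_ball.1 (h0.and (hU.mem_nhds hz))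
        have hc : ∀ x ∈ ball z r, g x = g z := by
          intro x hx
          have := (convex_ball z r).is_const_of_fderivWithin_eq_zero (𝕜 := ℂ) (f := g)
            (fun y hy => (hg y (hball y hy).2).mono (fun y hy => (hball y hy).2)) ?_ hx
            (mem_ball_self hr)
          · exact this
          · intro y hy
            rw [fderivWithin_of_isOpen isOpen_ball hy]
            ext
            simpa using (hball y hy).1
        have hx : z + (r/2 : ℝ) ∈ ball z r := by
          simp [abs_of_pos hr]; linarith
        have := hinj (hball _ hx).2 hz (hc _ hx)
        simp at this
        exact hr.ne' (by exact_mod_cast this)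
      · exact h0
    obtain ⟨t, hto, hzt, ht⟩ : ∃ t, IsOpen t ∧ z ∈ t ∧ ∀ x ∈ t, x ≠ z → deriv g x ≠ 0 := by
      rw [eventually_nhdsWithin_iff] at hne
      obtain ⟨t, h1, h2, h3⟩ := _root_.mem_nhds_iff.1 hne
      exact ⟨t, h2, h3, fun x hx hxz => h1 hx hxz⟩
    rw [eventually_nhdsWithin_iff]
    filter_upwards [(hopen _ inter_subset_right (hto.inter hU)).mem_nhds ⟨z, ⟨hzt, hz⟩, rfl⟩]
    rintro _ ⟨x, ⟨hx, hx'⟩, rfl⟩ hne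
    exact hd1 x hx' (ht x hx (fun e => hne (by simp [e])))
  refine ⟨hO, ?_, h, ?_, hleft⟩
  · intro z hz h0
    have e1 : HasDerivAt (h ∘ g) (deriv h (g z) * deriv g z) z :=
      (hd2 z hz).hasDerivAt.comp z (hg.differentiableAt (hU.mem_nhds hz)).hasDerivAt
    have e2 : HasDerivAt (h ∘ g) 1 z := by
      refine (hasDerivAt_id z).congr_of_eventuallyEq ?_
      filter_upwards [hU.mem_nhds hz] with y hy using hleft y hy
    have := e1.unique e2
    simp [h0] at this
  · rintro _ ⟨z, hz, rfl⟩
    exact (hd2 z hz).differentiableWithinAt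

open Filter Topology in
/-- transfer -/
theorem transfer {U V : Set ℂ} (hU : IsOpen U) (hV : IsOpen V) {g h : ℂ → ℂ}
    (hg : DifferentiableOn ℂ g U) (hh : DifferentiableOn ℂ h V)
    (hgU : g '' U = V) (hleft : ∀ z ∈ U, h (g z) = z) {u : ℂ → ℝ} (hu : TF V u) (p : ℝ)
    (hp : 1 ≤ p) :
    TF U (U.indicator (u ∘ g)) ∧ Dir (U.indicator (u ∘ g)) = Dir u ∧
    ∫ x, u x ^ p = ∫ z, (U.indicator (u ∘ g) z) ^ p * ‖deriv g z‖ ^ 2 := by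
  obtain ⟨hu1, hu2, hu3, hu4, hu5⟩ := hu
  have hmaps : ∀ z ∈ U, g z ∈ V := fun z hz => hgU ▸ ⟨z, hz, rfl⟩
  have hright : ∀ y ∈ V, h y ∈ U ∧ g (h y) = y := by
    intro y hy; rw [← hgU] at hy
    obtain ⟨z, hz, rfl⟩ := hy
    rw [hleft z hz]; exact ⟨hz, rfl⟩
  have hginj : InjOn g U := fun x hx y hy e => by rw [← hleft x hx, ← hleft y hy, e]
  set w := U.indicator (u ∘ g) with hw
  set K := h '' tsupport u with hK
  have hKc : IsCompact K := hu2.isCompact.image_of_continuousOn (hh.continuousOn.mono hu3)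
  have hKU : K ⊆ U := by rintro _ ⟨y, hy, rfl⟩; exact (hright y (hu3 hy)).1
  have hw0 : ∀ z ∉ K, w z = 0 := by
    intro z hz
    by_cases hzU : z ∈ U
    · rw [hw, indicator_of_mem hzU]
      by_contra hne
      exact hz ⟨g z, subset_tsupport _ hne, hleft z hzU⟩
    · exact indicator_of_notMem hzU _
  have hts : tsupport w ⊆ K :=
    closure_minimal (fun z hz => by by_contra hc; exact hz (hw0 z hc)) hKc.isClosed
  have hwU : ∀ z ∈ U, w =ᶠ[𝓝 z] u ∘ g := by
    intro z hz
    filter_upwards [hU.mem_nhds hz] with y hy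
    rw [hw, indicator_of_mem hy]
  have hgd : ∀ z ∈ U, HasFDerivAt g ((ContinuousLinearMap.toSpanSingleton ℂ (deriv g z)).restrictScalars ℝ) z := by
    intro z hz
    exact (hg.differentiableAt (hU.mem_nhds hz)).hasDerivAt.hasFDerivAt.restrictScalars ℝ
  have hdet : ∀ z, |((ContinuousLinearMap.toSpanSingleton ℂ (deriv g z)).restrictScalars ℝ).det| = ‖deriv g z‖ ^ 2 := by
    intro z
    have : (((ContinuousLinearMap.toSpanSingleton ℂ (deriv g z)).restrictScalars ℝ).det) = ‖deriv g z‖ ^ 2 := by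
      simp only [ContinuousLinearMap.det]
      erw [LinearMap.det_restrictScalars]
      rw [Algebra.norm_complex_eq]
      simp [Complex.normSq_eq_norm_sq, LinearMap.det_ring]
    rw [this, abs_of_nonneg (by positivity)]
  have hfd : ∀ z ∈ U, ‖fderiv ℝ w z‖ = ‖deriv g z‖ * ‖fderiv ℝ u (g z)‖ := by
    intro z hz
    rw [(hwU z hz).fderiv_eq]
    have hud : DifferentiableAt ℝ u (g z) := (hu1.differentiable (by simp)) _
    rw [(hud.hasFDerivAt.comp z (hgd z hz)).fderiv]
    set a := deriv g z
    set L := fderiv ℝ u (g z)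
    apply le_antisymm
    · refine ContinuousLinearMap.opNorm_le_bound _ (by positivity) fun x => ?_
      have := L.le_opNorm (x * a)
      simp only [ContinuousLinearMap.comp_apply, ContinuousLinearMap.coe_restrictScalars',
        ContinuousLinearMap.toSpanSingleton_apply, smul_eq_mul]
      rw [norm_mul] at this
      linarith
    · by_cases ha : a = 0
      · simp [ha]
      have ha' : 0 < ‖a‖ := norm_pos_iff.2 ha
      rw [mul_comm, ← le_div_iff₀ ha']
      refine ContinuousLinearMap.opNorm_le_bound _ (by positivity) fun x => ?_
      have := (L.comp ((ContinuousLinearMap.toSpanSingleton ℂ a).restrictScalars ℝ)).le_opNorm (x / a)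
      simp only [ContinuousLinearMap.comp_apply, ContinuousLinearMap.coe_restrictScalars',
        ContinuousLinearMap.toSpanSingleton_apply, smul_eq_mul, div_mul_cancel₀ _ ha, norm_div] at this
      refine this.trans (le_of_eq ?_)
      field_simp
  refine ⟨⟨?_, HasCompactSupport.intro hKc hw0, hts.trans hKU, ?_, ?_⟩, ?_, ?_⟩
  · rw [contDiff_iff_contDiffAt]
    intro z
    by_cases hz : z ∈ U
    · refine ContDiffAt.congr_of_eventuallyEq ?_ (hwU z hz)
      have : ContDiffAt ℂ (⊤ : ℕ∞) g z :=
        (hg.analyticAt (hU.mem_nhds hz)).contDiffAt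
      exact hu1.contDiffAt.comp z (this.restrict_scalars ℝ)
    · have : w =ᶠ[𝓝 z] fun _ => 0 := by
        filter_upwards [hKc.isClosed.isOpen_compl.mem_nhds (fun h => hz (hKU h))] with y hy
          using hw0 y hy
      exact contDiffAt_const.congr_of_eventuallyEq this
  · intro z; exact indicator_nonneg (fun _ _ => hu4 _) z
  · intro h0
    apply hu5
    ext y
    by_cases hy : y ∈ V
    · have := congrFun h0 (h y)
      rw [hw, indicator_of_mem (hright y hy).1] at this
      simpa [(hright y hy).2] using this
    · exact image_eq_zero_of_notMem_tsupport (fun h => hy (hu3 h))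
  · unfold Dir
    have e1 : ∫ x, ‖fderiv ℝ u x‖ ^ 2 = ∫ x in V, ‖fderiv ℝ u x‖ ^ 2 := by
      symm
      apply setIntegral_eq_integral_of_forall_compl_eq_zero
      intro x hx
      rw [fderiv_of_notMem_tsupport ℝ (fun h => hx (hu3 h))]; simp
    have e2 : ∫ x, ‖fderiv ℝ w x‖ ^ 2 = ∫ x in U, ‖fderiv ℝ w x‖ ^ 2 := by
      symm
      apply setIntegral_eq_integral_of_forall_compl_eq_zero
      intro x hx
      rw [fderiv_of_notMem_tsupport ℝ (fun h => hx (hKU (hts h)))]; simp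
    rw [e1, e2, ← hgU, integral_image_eq_integral_abs_det_fderiv_smul volume hU.measurableSet
      (fun z hz => (hgd z hz).hasFDerivWithinAt) hginj]
    refine setIntegral_congr_fun hU.measurableSet fun z hz => ?_
    simp only [hdet, hfd z hz, smul_eq_mul]; ring
  · have hp0 : p ≠ 0 := by linarith
    have e1 : ∫ x, u x ^ p = ∫ x in V, u x ^ p := by
      symm
      apply setIntegral_eq_integral_of_forall_compl_eq_zero
      intro x hx
      rw [image_eq_zero_of_notMem_tsupport (fun h => hx (hu3 h)), zero_rpow hp0]
    have e2 : ∫ z, w z ^ p * ‖deriv g z‖ ^ 2 = ∫ x in U, w x ^ p * ‖deriv g x‖ ^ 2 := by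
      symm
      apply setIntegral_eq_integral_of_forall_compl_eq_zero
      intro x hx
      rw [hw0 x (fun h => hx (hKU h)), zero_rpow hp0, zero_mul]
    rw [e1, e2, ← hgU, integral_image_eq_integral_abs_det_fderiv_smul volume hU.measurableSet
      (fun z hz => (hgd z hz).hasFDerivWithinAt) hginj]
    refine setIntegral_congr_fun hU.measurableSet fun z hz => ?_
    simp only [hdet, hw, indicator_of_mem hz, smul_eq_mul, Function.comp]; ring

theorem hlp {E : Type*} [NormedAddCommGroup E] (f : ℂ → E) {s : Set ℂ}
    (h : Function.support f ⊆ s) (p : ENNReal) :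
    eLpNorm f p volume = eLpNorm f p (volume.restrict s) :=
  (eLpNorm_restrict_eq_of_support_subset h).symm

theorem rpow_cont {q : ℝ} (hq : 1 ≤ q) {w : ℂ → ℝ} (hw : Continuous w) :
    Continuous fun x => w x ^ q :=
  hw.rpow_const fun _ => Or.inr (by linarith)

theorem rpow_supp {q : ℝ} (hq : 1 ≤ q) {w : ℂ → ℝ} (hw : HasCompactSupport w) :
    HasCompactSupport fun x => w x ^ q :=
  hw.comp_left (g := fun t : ℝ => t ^ q) (zero_rpow (by linarith))

theorem sob (q : ℝ) (hq : 1 ≤ q) : ∃ C : ℝ, 0 < C ∧ ∀ w, TF (ball 0 1) w →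
    ∫ x, w x ^ q ≤ C * Dir w ^ (q / 2) := by
  have hq0 : 0 < q := by linarith
  set B : Set ℂ := ball 0 1 with hB
  let Q : NNReal := ⟨q, hq0.le⟩
  let P : NNReal := ⟨2 * q / (q + 1), by positivity⟩
  have hP1 : 1 ≤ P := by
    rw [← NNReal.coe_le_coe]; show (1:ℝ) ≤ 2 * q / (q + 1)
    rw [le_div_iff₀ (by linarith)]; linarith
  have hP2 : P < 2 := by
    rw [← NNReal.coe_lt_coe]; show 2 * q / (q + 1) < (2:ℝ)
    rw [div_lt_iff₀ (by linarith)]; linarith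
  set C1 : NNReal := eLpNormLESNormFDerivOfLeConst ℝ (volume : Measure ℂ) B P Q with hC1
  set E : ENNReal := C1 * (volume B) ^ (1 / (P:ENNReal).toReal - 1 / (2:ENNReal).toReal) with hE
  have hvol : volume B ≠ ⊤ := measure_ball_lt_top.ne
  have hvol0 : volume B ≠ 0 := (measure_ball_pos volume 0 one_pos).ne'
  have hEt : E ≠ ⊤ := ENNReal.mul_ne_top ENNReal.coe_ne_top
    (by simp [hvol, hvol0, ENNReal.rpow_eq_top_iff])
  refine ⟨(E.toReal + 1) ^ q, by positivity, ?_⟩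
  rintro w ⟨h1, h2, h3, h4, h5⟩
  have hsupp : w.support ⊆ B := (subset_tsupport w).trans h3
  have hfc : Continuous (fderiv ℝ w) := h1.continuous_fderiv (by simp)
  have hfs : HasCompactSupport (fderiv ℝ w) := h2.fderiv (𝕜 := ℝ)
  have k1 : eLpNorm w Q volume ≤ C1 * eLpNorm (fderiv ℝ w) P volume := by
    refine eLpNorm_le_eLpNorm_fderiv_of_le volume (h1.of_le (by simp)) hsupp hP1 ?_ ?_
      isBounded_ball
    · rw [Complex.finrank_real_complex]; exact_mod_cast hP2
    · rw [Complex.finrank_real_complex]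
      show ((2 * q / (q + 1))⁻¹ - ((2:ℕ):ℝ)⁻¹ : ℝ) ≤ q⁻¹
      have : (2 * q / (q + 1))⁻¹ - ((2:ℕ):ℝ)⁻¹ = q⁻¹ / 2 := by
        push_cast; field_simp; ring
      rw [this]
      have : 0 < q⁻¹ := by positivity
      linarith
  have k2 : eLpNorm (fderiv ℝ w) P volume = eLpNorm (fderiv ℝ w) P (volume.restrict B) := by
    exact hlp (fderiv ℝ w) ((support_fderiv_subset ℝ).trans h3) P
  have k3 : eLpNorm (fderiv ℝ w) P (volume.restrict B) ≤
      eLpNorm (fderiv ℝ w) 2 (volume.restrict B) *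
        (volume B) ^ (1 / (P:ENNReal).toReal - 1 / (2:ENNReal).toReal) := by
    have := eLpNorm_le_eLpNorm_mul_rpow_measure_univ (μ := volume.restrict B) (p := P) (q := 2)
      (f := fderiv ℝ w) (by exact_mod_cast hP2.le) hfc.aestronglyMeasurable
    simpa using this
  have k4 : eLpNorm (fderiv ℝ w) 2 (volume.restrict B) ≤ eLpNorm (fderiv ℝ w) 2 volume :=
    eLpNorm_mono_measure _ Measure.restrict_le_self
  have k5 : eLpNorm w Q volume ≤ E * eLpNorm (fderiv ℝ w) 2 volume := by
    refine k1.trans ?_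
    rw [k2, hE, mul_assoc, mul_comm (volume B ^ _)]
    gcongr
    exact k3.trans (by gcongr)
  have m1 : MemLp w Q volume := h1.continuous.memLp_of_hasCompactSupport h2
  have m2 : MemLp (fderiv ℝ w) 2 volume := hfc.memLp_of_hasCompactSupport hfs
  have hQ0 : (Q : ENNReal) ≠ 0 := by
    have : Q ≠ 0 := fun h => hq0.ne' (congrArg NNReal.toReal h)
    exact_mod_cast this
  rw [m1.eLpNorm_eq_integral_rpow_norm hQ0 ENNReal.coe_ne_top,
    m2.eLpNorm_eq_integral_rpow_norm (by simp) (by simp)] at k5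
  have hQr : (Q : ENNReal).toReal = q := rfl
  have e1 : ∫ x, ‖w x‖ ^ q = ∫ x, w x ^ q := by
    congr 1; ext x; rw [norm_of_nonneg (h4 x)]
  have e2 : ∫ x, ‖fderiv ℝ w x‖ ^ (2:ENNReal).toReal = Dir w := by
    unfold Dir; congr 1; ext x; simp
  rw [hQr, e1, e2] at k5
  have hD0 : 0 ≤ Dir w := integral_nonneg fun x => by positivity
  have hA0 : 0 ≤ ∫ x, w x ^ q := integral_nonneg fun x => rpow_nonneg (h4 x) _
  have k6 : (∫ x, w x ^ q) ^ q⁻¹ ≤ E.toReal * Dir w ^ (1/2:ℝ) := by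
    have := ENNReal.toReal_mono (ENNReal.mul_ne_top hEt ENNReal.ofReal_ne_top) k5
    rw [ENNReal.toReal_mul, ENNReal.toReal_ofReal (by positivity),
      ENNReal.toReal_ofReal (by positivity)] at this
    simpa using this
  have k7 : ((∫ x, w x ^ q) ^ q⁻¹) ^ q ≤ ((E.toReal + 1) * Dir w ^ (1/2:ℝ)) ^ q := by
    refine rpow_le_rpow (by positivity) (k6.trans ?_) hq0.le
    gcongr
    linarith
  rw [← rpow_mul hA0, inv_mul_cancel₀ hq0.ne', rpow_one, mul_rpow (by positivity) (by positivity),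
    ← rpow_mul hD0] at k7
  refine k7.trans (le_of_eq ?_)
  congr 2; ring

theorem int_pos {D : Set ℂ} {p : ℝ} (hp : 1 ≤ p) {w : ℂ → ℝ} (hw : TF D w) {k : ℂ → ℝ}
    (hk : Continuous k) (hk0 : ∀ x ∈ D, 0 < k x) :
    0 < ∫ x, w x ^ p * k x := by
  obtain ⟨h1, h2, h3, h4, h5⟩ := hw
  obtain ⟨x, hx⟩ : ∃ x, w x ≠ 0 := by
    by_contra! h; exact h5 (funext h)
  have hxD : x ∈ D := h3 (subset_tsupport _ hx)
  refine Continuous.integral_pos_of_hasCompactSupport_nonneg_nonzero (x := x)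
    ((rpow_cont hp h1.continuous).mul hk) ((rpow_supp hp h2).mul_right) ?_ ?_
  · intro y
    by_cases hy : y ∈ D
    · exact mul_nonneg (rpow_nonneg (h4 y) _) (hk0 y hy).le
    · have : w y = 0 := image_eq_zero_of_notMem_tsupport (fun h => hy (h3 h))
      simp [this, zero_rpow (by linarith : p ≠ 0)]
  · exact mul_ne_zero (rpow_pos_of_pos (lt_of_le_of_ne (h4 x) hx.symm) _).ne' (hk0 x hxD).ne'

theorem dir_pos {w : ℂ → ℝ} (hw : TF (ball 0 1) w) : 0 < Dir w := by
  have hD0 : 0 ≤ Dir w := integral_nonneg fun x => by positivity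
  obtain ⟨C, hC, h⟩ := sob 2 (by norm_num)
  have h1 := h w hw
  have h2 := int_pos (p := 2) (by norm_num) hw (k := fun _ => 1) continuous_const
    (fun _ _ => one_pos)
  simp only [mul_one] at h2
  rcases hD0.eq_or_lt with h0 | h0
  · rw [← h0] at h1
    norm_num at h1
    norm_num at h2
    linarith
  · exact h0

theorem exists_ext {f : ℂ → ℂ} (hf : DifferentiableOn ℂ f (ball 0 1)) {r : ℝ} (hr : r < 1) :
    ∃ F : ℂ → ℂ, Continuous F ∧ ∀ z ∈ closedBall (0:ℂ) r, F z = deriv f z := by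
  have hsub : closedBall (0:ℂ) r ⊆ ball 0 1 := closedBall_subset_ball hr
  have hc : ContinuousOn (deriv f) (closedBall (0:ℂ) r) :=
    ((hf.analyticOnNhd isOpen_ball).deriv.continuousOn).mono hsub
  obtain ⟨g, hg⟩ := ContinuousMap.exists_restrict_eq (s := closedBall (0:ℂ) r) isClosed_closedBall
    ⟨_, hc.domRestrict⟩
  refine ⟨g, g.continuous, fun z hz => ?_⟩
  have := congrArg (fun k => k ⟨z, hz⟩) hg
  simpa using this

theorem exists_TF : ∃ w, TF (ball 0 1) w := by
  let b : ContDiffBump (0:ℂ) := ⟨1/4, 1/2, by norm_num, by norm_num⟩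
  refine ⟨b, b.contDiff, b.hasCompactSupport, ?_, fun _ => b.nonneg, ?_⟩
  · rw [b.tsupport_eq]; exact closedBall_subset_ball (by norm_num [b])
  · intro h
    have h1 := b.one_of_mem_closedBall (x := 0) (mem_closedBall_self b.rIn_pos.le)
    rw [h] at h1
    simp at h1

theorem mem_r {r : ℝ} {ζ z : ℂ} (hζ : ‖ζ‖ ≤ r) (hz : ‖z‖ ≤ 1) : ζ * z ∈ closedBall (0:ℂ) r := by
  simp only [mem_closedBall, dist_zero_right, norm_mul]
  nlinarith [norm_nonneg ζ, norm_nonneg z]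

/-- the basic functional -/
noncomputable def GG (p : ℝ) (F : ℂ → ℂ) (w : ℂ → ℝ) (ζ : ℂ) : ℝ :=
  ∫ z, w z ^ p * ‖F (ζ * z)‖ ^ 2

theorem GG_le {p : ℝ} (hp : 1 ≤ p) {F : ℂ → ℂ} (hF : Continuous F) {r M : ℝ}
    (hM : ∀ z ∈ closedBall (0:ℂ) r, ‖F z‖ ^ 2 ≤ M) {w : ℂ → ℝ} (hw : TF (ball 0 1) w) {ζ : ℂ}
    (hζ : ‖ζ‖ ≤ r) : GG p F w ζ ≤ M * ∫ z, w z ^ p := by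
  obtain ⟨h1, h2, h3, h4, h5⟩ := hw
  have hc : Continuous fun z => ‖F (ζ * z)‖ ^ 2 := by fun_prop
  rw [GG, ← integral_const_mul]
  refine integral_mono ?_ ?_ ?_
  · exact ((rpow_cont hp h1.continuous).mul hc).integrable_of_hasCompactSupport
      ((rpow_supp hp h2).mul_right)
  · exact ((rpow_cont hp h1.continuous).integrable_of_hasCompactSupport (rpow_supp hp h2)).const_mul _
  · intro z
    by_cases hz : z ∈ ball (0:ℂ) 1
    · have := hM _ (mem_r hζ (by simpa using (mem_ball_zero_iff.1 hz).le))
      have h0 : 0 ≤ w z ^ p := rpow_nonneg (h4 z) _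
      simp only
      nlinarith
    · have : w z = 0 := image_eq_zero_of_notMem_tsupport (fun h => hz (h3 h))
      simp [this, zero_rpow (by linarith : p ≠ 0)]

theorem lub {p : ℝ} (hp : 1 ≤ p) {f : ℂ → ℂ} (hf : DifferentiableOn ℂ f (ball 0 1))
    (hinj : InjOn f (ball 0 1)) {F : ℂ → ℂ} (hF : Continuous F) {r : ℝ} (hr : r < 1)
    (hFf : ∀ z ∈ closedBall (0:ℂ) r, F z = deriv f z) {M : ℝ}
    (hM : ∀ z ∈ closedBall (0:ℂ) r, ‖F z‖ ^ 2 ≤ M) {ζ : ℂ} (hζ : ‖ζ‖ ≤ r) :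
    0 < Psi f p ζ ^ (p / 2) ∧
    IsLUB {c | ∃ w, TF (ball 0 1) w ∧ c = GG p F w ζ / Dir w ^ (p / 2)} (Psi f p ζ ^ (p / 2)) := by
  have hp0 : 0 < p := by linarith
  have hf' := (inv_lemma hf hinj).2.1
  have hζb : ∀ z ∈ ball (0:ℂ) 1, ζ * z ∈ ball (0:ℂ) 1 := fun z hz =>
    closedBall_subset_ball hr (mem_r hζ (mem_ball_zero_iff.1 hz).le)
  -- the map g
  obtain ⟨g, hΩ, hgd, hgi, hg'⟩ : ∃ g : ℂ → ℂ, OmegaZ f ζ = g '' ball 0 1 ∧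
      DifferentiableOn ℂ g (ball 0 1) ∧ InjOn g (ball 0 1) ∧
      ∀ z ∈ ball (0:ℂ) 1, deriv g z = deriv f (ζ * z) := by
    by_cases h0 : ζ = 0
    · refine ⟨fun z => deriv f 0 * z, by simp [OmegaZ, h0], by fun_prop, ?_, ?_⟩
      · intro x _ y _ h
        exact mul_left_cancel₀ (hf' 0 (by simp)) h
      · intro z _
        simp [h0]
    · refine ⟨fun z => f (ζ * z) / ζ, by simp [OmegaZ, h0], ?_, ?_, ?_⟩
      · exact (hf.comp (by fun_prop) hζb).div_const ζ
      · intro x hx y hy h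
        have h1 : f (ζ * x) = f (ζ * y) := by
          simpa [h0, div_left_inj'] using h
        exact mul_left_cancel₀ h0 (hinj (hζb x hx) (hζb y hy) h1)
      · intro z hz
        have e1 : HasDerivAt f (deriv f (ζ * z)) (ζ * z) :=
          (hf.differentiableAt (isOpen_ball.mem_nhds (hζb z hz))).hasDerivAt
        have e2 : HasDerivAt (fun z => ζ * z) ζ z := by
          simpa using (hasDerivAt_id z).const_mul ζ
        have e3 := (e1.comp z e2).div_const ζ
        rw [mul_div_assoc, div_self h0, mul_one] at e3
        exact e3.deriv
  obtain ⟨hO, -, h, hhd, hleft⟩ := inv_lemma hgd hgi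
  have hGG : ∀ w, TF (ball 0 1) w → GG p F w ζ = ∫ z, w z ^ p * ‖deriv g z‖ ^ 2 := by
    rintro w ⟨h1, h2, h3, h4, h5⟩
    unfold GG
    congr 1
    ext z
    by_cases hz : z ∈ ball (0:ℂ) 1
    · rw [hg' z hz, hFf _ (mem_r hζ (mem_ball_zero_iff.1 hz).le)]
    · have : w z = 0 := image_eq_zero_of_notMem_tsupport (fun h => hz (h3 h))
      simp [this, zero_rpow (by linarith : p ≠ 0)]
  set S := {c : ℝ | ∃ w, TF (ball 0 1) w ∧ c = Dir w / GG p F w ζ ^ (2 / p)} with hS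
  have hCp : Cp p (OmegaZ f ζ) = sInf S := by
    rw [hΩ, Cp]
    congr 1
    ext c
    constructor
    · rintro ⟨u, u1, u2, u3, u4, u5, rfl⟩
      obtain ⟨t1, t2, t3⟩ := transfer isOpen_ball hO hgd hhd rfl hleft
        (u := u) ⟨u1, u2, u3, u4, u5⟩ p hp
      refine ⟨_, t1, ?_⟩
      rw [hGG _ t1, t2, t3, Dir]
    · rintro ⟨w, hw, rfl⟩
      have himg : h '' (g '' ball 0 1) = ball 0 1 := by
        rw [image_image]
        exact (image_congr hleft).trans (image_id' _)
      have hright : ∀ y ∈ g '' ball 0 1, g (h y) = y := by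
        rintro _ ⟨z, hz, rfl⟩; rw [hleft z hz]
      obtain ⟨t1, -, -⟩ := transfer hO isOpen_ball hhd hgd himg hright (u := w) hw p hp
      obtain ⟨s1, s2, s3⟩ := transfer isOpen_ball hO hgd hhd rfl hleft t1 p hp
      have hww : (ball (0:ℂ) 1).indicator (((g '' ball 0 1).indicator (w ∘ h)) ∘ g) = w := by
        ext z
        by_cases hz : z ∈ ball (0:ℂ) 1
        · rw [indicator_of_mem hz, Function.comp, indicator_of_mem (mem_image_of_mem g hz),
            Function.comp, hleft z hz]
        · rw [indicator_of_notMem hz]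
          exact (image_eq_zero_of_notMem_tsupport (fun h => hz (hw.2.2.1 h))).symm
      rw [hww] at s2 s3
      obtain ⟨u1, u2, u3, u4, u5⟩ := t1
      refine ⟨_, u1, u2, u3, u4, u5, ?_⟩
      rw [s3, hGG w hw, s2, Dir]
  have hGpos : ∀ w, TF (ball 0 1) w → 0 < GG p F w ζ := by
    intro w hw
    refine int_pos hp hw (k := fun z => ‖F (ζ * z)‖ ^ 2) (by fun_prop) ?_
    intro z hz
    rw [hFf _ (mem_r hζ (mem_ball_zero_iff.1 hz).le)]
    have := norm_pos_iff.2 (hf' _ (hζb z hz))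
    positivity
  obtain ⟨w0, hw0⟩ := exists_TF
  have hSne : S.Nonempty := ⟨_, w0, hw0, rfl⟩
  have key : ∀ B : ℝ, 0 < B → (∀ w, TF (ball 0 1) w → GG p F w ζ / Dir w ^ (p / 2) ≤ B) →
      (B ^ (2 / p))⁻¹ ≤ sInf S := by
    intro B hB hall
    refine le_csInf hSne ?_
    rintro _ ⟨w, hw, rfl⟩
    have hD := dir_pos hw
    have hG := hGpos w hw
    have h1 := hall w hw
    rw [div_le_iff₀ (by positivity)] at h1
    have h2 := rpow_le_rpow hG.le h1 (by positivity : 0 ≤ 2 / p)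
    rw [mul_rpow hB.le (by positivity), ← rpow_mul hD.le,
      show p / 2 * (2 / p) = 1 by field_simp, rpow_one] at h2
    rw [le_div_iff₀ (by positivity), inv_mul_le_iff₀ (by positivity)]
    exact h2
  obtain ⟨C, hC, hsob⟩ := sob p hp
  have hMC : ∀ w, TF (ball 0 1) w → GG p F w ζ / Dir w ^ (p / 2) ≤ (|M| + 1) * C := by
    intro w hw
    have hD := dir_pos hw
    rw [div_le_iff₀ (by positivity)]
    have h1 := GG_le hp hF hM hw hζ
    have h2 := hsob w hw
    have h3 : 0 ≤ ∫ z, w z ^ p := integral_nonneg fun x => rpow_nonneg (hw.2.2.2.1 x) _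
    calc _ ≤ _ := h1
      _ ≤ (|M| + 1) * ∫ z, w z ^ p := by
        apply mul_le_mul_of_nonneg_right _ h3
        linarith [le_abs_self M]
      _ ≤ (|M| + 1) * (C * Dir w ^ (p / 2)) := by gcongr
      _ = _ := by ring
  have hI : 0 < sInf S := lt_of_lt_of_le (by positivity) (key ((|M| + 1) * C) (by positivity) hMC)
  have hbdd : BddBelow S := by
    refine ⟨0, ?_⟩
    rintro _ ⟨w, hw, rfl⟩
    have hD := dir_pos hw
    have hG := hGpos w hw
    positivity
  rw [Psi, hCp]
  refine ⟨by positivity, ?_, ?_⟩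
  · rintro _ ⟨w, hw, rfl⟩
    have hD := dir_pos hw
    have hG := hGpos w hw
    have h1 : sInf S ≤ Dir w / GG p F w ζ ^ (2 / p) := csInf_le hbdd ⟨w, hw, rfl⟩
    have h2 : GG p F w ζ ^ (2 / p) / Dir w ≤ 1 / sInf S := by
      rw [le_div_iff₀ hI, div_mul_eq_mul_div, div_le_one hD]
      rwa [le_div_iff₀ (by positivity), mul_comm] at h1
    have h3 := rpow_le_rpow (by positivity) h2 (by positivity : 0 ≤ p / 2)
    rwa [div_rpow (by positivity) hD.le, ← rpow_mul hG.le,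
      show 2 / p * (p / 2) = 1 by field_simp, rpow_one] at h3
  · intro B hB
    have hB0 : 0 < B := by
      have := hB ⟨w0, hw0, rfl⟩
      have hD := dir_pos hw0
      have hG := hGpos w0 hw0
      exact lt_of_lt_of_le (by positivity) this
    have h1 := key B hB0 (fun w hw => hB ⟨w, hw, rfl⟩)
    have h2 : 1 / sInf S ≤ B ^ (2 / p) := by
      rw [one_div]; exact inv_le_of_inv_le₀ (by positivity) h1
    have h3 := rpow_le_rpow (by positivity) h2 (by positivity : 0 ≤ p / 2)
    rwa [← rpow_mul hB0.le, show 2 / p * (p / 2) = 1 by field_simp, rpow_one] at h3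

/-- circle parametrization -/
noncomputable def cir (ζ : ℂ) (ρ θ : ℝ) : ℂ := ζ + (ρ : ℂ) * Complex.exp (θ * Complex.I)

theorem cir_cont (ζ : ℂ) (ρ : ℝ) : Continuous (cir ζ ρ) := by unfold cir; fun_prop

theorem cir_norm (ζ : ℂ) {ρ : ℝ} (hρ : 0 < ρ) (θ : ℝ) : ‖cir ζ ρ θ‖ ≤ ‖ζ‖ + ρ := by
  refine (norm_add_le _ _).trans ?_
  simp [Complex.norm_exp_ofReal_mul_I, abs_of_pos hρ]

/-- the defect -/
noncomputable def hh (F : ℂ → ℂ) (ζ : ℂ) (ρ : ℝ) (z : ℂ) : ℝ :=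
  (2 * π)⁻¹ * ∫ θ in (0:ℝ)..2 * π, ‖F (cir ζ ρ θ * z) - F (ζ * z)‖ ^ 2

theorem hh_nonneg (F : ℂ → ℂ) (ζ : ℂ) (ρ : ℝ) (z : ℂ) : 0 ≤ hh F ζ ρ z := by
  have := pi_pos
  refine mul_nonneg (by positivity) (intervalIntegral.integral_nonneg (by positivity) ?_)
  intro θ _; positivity

theorem hh_cont {F : ℂ → ℂ} (hF : Continuous F) (ζ : ℂ) (ρ : ℝ) : Continuous (hh F ζ ρ) := by
  have hc := cir_cont ζ ρ
  refine continuous_const.mul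
    (intervalIntegral.continuous_parametric_intervalIntegral_of_continuous' ?_ _ _)
  simp only [Function.uncurry_def]
  fun_prop

theorem mean_id {f : ℂ → ℂ} (hf : DifferentiableOn ℂ f (ball 0 1))
    {F : ℂ → ℂ} (hF : Continuous F) {ζ : ℂ} {ρ : ℝ} (hρ : 0 < ρ) (hr : ‖ζ‖ + ρ < 1)
    (hFf : ∀ z ∈ closedBall (0:ℂ) (‖ζ‖ + ρ), F z = deriv f z) {z : ℂ} (hz : ‖z‖ ≤ 1) :
    (2 * π)⁻¹ * ∫ θ in (0:ℝ)..2 * π, ‖F (cir ζ ρ θ * z)‖ ^ 2 = ‖F (ζ * z)‖ ^ 2 + hh F ζ ρ z := by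
  have hπ := pi_pos
  have hc := cir_cont ζ ρ
  have hζ : ‖ζ‖ ≤ ‖ζ‖ + ρ := by linarith
  set b := F (ζ * z) with hb
  have hmean : (2 * π)⁻¹ • ∫ θ in (0:ℝ)..2 * π, F (cir ζ ρ θ * z) = b := by
    have hd : DifferentiableOn ℂ (fun ξ => deriv f (ξ * z)) (closedBall ζ ρ) := by
      refine ((hf.analyticOnNhd isOpen_ball).deriv.differentiableOn).comp (by fun_prop) ?_
      intro ξ hξ
      refine closedBall_subset_ball hr (mem_r ?_ hz)
      have : ‖ξ - ζ‖ ≤ ρ := by simpa [dist_eq_norm] using hξ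
      calc ‖ξ‖ = ‖ζ + (ξ - ζ)‖ := by ring_nf
        _ ≤ _ := (norm_add_le _ _).trans (by linarith)
    have h1 : DiffContOnCl ℂ (fun ξ => deriv f (ξ * z)) (ball ζ |ρ|) := by
      rw [abs_of_pos hρ]
      apply DifferentiableOn.diffContOnCl
      rwa [closure_ball _ hρ.ne']
    have h2 := h1.circleAverage
    rw [circleAverage_def] at h2
    rw [hb, hFf _ (mem_r hζ hz), ← h2]
    congr 1
    refine intervalIntegral.integral_congr fun θ _ => ?_
    exact hFf _ (mem_r (cir_norm ζ hρ θ) hz)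
  have hI1 : IntervalIntegrable (fun θ => F (cir ζ ρ θ * z)) volume 0 (2 * π) :=
    Continuous.intervalIntegrable (by fun_prop) _ _
  have hmean2 : (2 * π)⁻¹ * ∫ θ in (0:ℝ)..2 * π, inner ℝ (F (cir ζ ρ θ * z)) b = ‖b‖ ^ 2 := by
    have h1 : ∫ θ in (0:ℝ)..2 * π, inner ℝ (F (cir ζ ρ θ * z)) b =
        inner ℝ (∫ θ in (0:ℝ)..2 * π, F (cir ζ ρ θ * z)) b := by
      have := (innerSL ℝ b).intervalIntegral_comp_comm hI1
      simp only [innerSL_apply_apply] at this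
      simp_rw [real_inner_comm]
      exact this
    rw [h1, ← real_inner_smul_left, hmean, real_inner_self_eq_norm_sq]
  have hexp : ∀ θ, ‖F (cir ζ ρ θ * z) - b‖ ^ 2 =
      ‖F (cir ζ ρ θ * z)‖ ^ 2 - 2 * inner ℝ (F (cir ζ ρ θ * z)) b + ‖b‖ ^ 2 :=
    fun θ => norm_sub_sq_real _ _
  have hcon : Continuous fun θ => inner ℝ (F (cir ζ ρ θ * z)) b := by fun_prop
  unfold hh
  simp_rw [← hb, hexp]
  rw [intervalIntegral.integral_add, intervalIntegral.integral_sub,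
    intervalIntegral.integral_const_mul, intervalIntegral.integral_const, mul_add, mul_sub]
  · rw [mul_left_comm _ (2:ℝ), hmean2]
    simp only [sub_zero, smul_eq_mul]
    generalize (∫ θ in (0:ℝ)..2 * π, ‖F (cir ζ ρ θ * z)‖ ^ 2) = A
    field_simp
    ring
  · exact Continuous.intervalIntegrable (by fun_prop) _ _
  · exact Continuous.intervalIntegrable (by fun_prop) _ _
  · exact Continuous.intervalIntegrable (by fun_prop) _ _
  · exact Continuous.intervalIntegrable (by fun_prop) _ _

open Filter Topology in
theorem hh_pos {f : ℂ → ℂ} (hf : DifferentiableOn ℂ f (ball 0 1))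
    (hna : ¬ (∃ a b : ℂ, ∀ z ∈ ball (0 : ℂ) 1, f z = a * z + b))
    {F : ℂ → ℂ} (hF : Continuous F) {ζ : ℂ} {ρ : ℝ} (hρ : 0 < ρ) (hr : ‖ζ‖ + ρ < 1)
    (hFf : ∀ z ∈ closedBall (0:ℂ) (‖ζ‖ + ρ), F z = deriv f z) {z : ℂ} (hz : ‖z‖ ≤ 1)
    (hz0 : z ≠ 0) : 0 < hh F ζ ρ z := by
  have hπ := pi_pos
  have hc := cir_cont ζ ρ
  have hζ : ‖ζ‖ ≤ ‖ζ‖ + ρ := by linarith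
  refine mul_pos (by positivity) ?_
  refine intervalIntegral.integral_pos (by positivity) (Continuous.continuousOn (by fun_prop))
    (fun _ _ => by positivity) ?_
  by_contra! hcon
  have hconst : ∀ θ ∈ Icc 0 (2 * π), deriv f (cir ζ ρ θ * z) = F (ζ * z) := by
    intro θ hθ
    have h1 := hcon θ hθ
    have h2 : ‖F (cir ζ ρ θ * z) - F (ζ * z)‖ ^ 2 = 0 := le_antisymm h1 (by positivity)
    rw [← hFf _ (mem_r (cir_norm ζ hρ θ) hz)]
    exact sub_eq_zero.1 (norm_eq_zero.1 (pow_eq_zero_iff (two_ne_zero) |>.1 h2))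
  have han : AnalyticOnNhd ℂ (deriv f) (ball 0 1) := (hf.analyticOnNhd isOpen_ball).deriv
  have heq : EqOn (deriv f) (fun _ => F (ζ * z)) (ball 0 1) := by
    refine han.eqOn_of_preconnected_of_frequently_eq (z₀ := cir ζ ρ 0 * z) analyticOnNhd_const
      (convex_ball 0 1).isPreconnected
      (closedBall_subset_ball hr (mem_r (cir_norm ζ hρ 0) hz)) ?_
    have ht : Tendsto (fun θ : ℝ => cir ζ ρ θ * z) (𝓝[>] 0) (𝓝[≠] (cir ζ ρ 0 * z)) := by
      refine tendsto_nhdsWithin_iff.2 ⟨?_, ?_⟩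
      · exact (Continuous.tendsto (by fun_prop) 0).mono_left nhdsWithin_le_nhds
      · filter_upwards [Ioo_mem_nhdsGT hπ] with θ hθ he
        have h1 := mul_right_cancel₀ hz0 he
        simp only [cir, add_right_inj] at h1
        have h2 := mul_left_cancel₀ (by exact_mod_cast hρ.ne') h1
        have h3 := congrArg Complex.im h2
        rw [Complex.exp_ofReal_mul_I_im, Complex.exp_ofReal_mul_I_im, sin_zero] at h3
        exact (sin_pos_of_pos_of_lt_pi hθ.1 hθ.2).ne' h3
    refine ht.frequently (Eventually.frequently ?_)
    filter_upwards [Ioo_mem_nhdsGT hπ] with θ hθ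
    exact hconst θ ⟨hθ.1.le, by linarith [hθ.2]⟩
  apply hna
  refine ⟨F (ζ * z), f 0, fun x hx => ?_⟩
  set a := F (ζ * z)
  have hk : DifferentiableOn ℂ (fun x => f x - a * x) (ball 0 1) := hf.sub (by fun_prop)
  have := (convex_ball (0:ℂ) 1).is_const_of_fderivWithin_eq_zero (𝕜 := ℂ)
    (f := fun x => f x - a * x) hk ?_ hx (mem_ball_self one_pos)
  · simp only [mul_zero, sub_zero] at this
    linear_combination this
  · intro y hy
    rw [fderivWithin_of_isOpen isOpen_ball hy]
    have h1 : HasDerivAt f (deriv f y) y :=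
      (hf.differentiableAt (isOpen_ball.mem_nhds hy)).hasDerivAt
    have h2 := h1.sub ((hasDerivAt_id y).const_mul a)
    have h3 : deriv (fun x => f x - a * x) y = 0 := by
      refine h2.deriv.trans ?_
      rw [heq hy]; simp
    ext
    simpa using h3

theorem swap {p : ℝ} (hp : 1 ≤ p) {f : ℂ → ℂ} (hf : DifferentiableOn ℂ f (ball 0 1))
    {F : ℂ → ℂ} (hF : Continuous F) {ζ : ℂ} {ρ : ℝ} (hρ : 0 < ρ) (hr : ‖ζ‖ + ρ < 1)
    (hFf : ∀ z ∈ closedBall (0:ℂ) (‖ζ‖ + ρ), F z = deriv f z) {w : ℂ → ℝ}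
    (hw : TF (ball 0 1) w) :
    (Continuous fun θ => GG p F w (cir ζ ρ θ)) ∧
    (2 * π)⁻¹ * ∫ θ in (0:ℝ)..2 * π, GG p F w (cir ζ ρ θ) =
      GG p F w ζ + ∫ z, w z ^ p * hh F ζ ρ z := by
  obtain ⟨h1, h2, h3, h4, h5⟩ := hw
  have hc := cir_cont ζ ρ
  have hwp := rpow_cont hp h1.continuous
  have hwz : ∀ z ∉ closedBall (0:ℂ) 1, w z ^ p = 0 := by
    intro z hz
    have : w z = 0 := image_eq_zero_of_notMem_tsupport
      (fun h => hz (ball_subset_closedBall (h3 h)))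
    simp [this, zero_rpow (by linarith : p ≠ 0)]
  have hset : ∀ k : ℂ → ℝ, ∫ z, w z ^ p * k z = ∫ z in closedBall (0:ℂ) 1, w z ^ p * k z := by
    intro k
    symm
    apply setIntegral_eq_integral_of_forall_compl_eq_zero
    intro z hz
    rw [hwz z hz, zero_mul]
  have hcont : Continuous (Function.uncurry
      fun (θ : ℝ) (z : ℂ) => w z ^ p * ‖F (cir ζ ρ θ * z)‖ ^ 2) := by
    simp only [Function.uncurry_def]
    exact (hwp.comp continuous_snd).mul (by fun_prop)
  refine ⟨?_, ?_⟩
  · simp only [GG, hset]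
    exact continuous_parametric_integral_of_continuous hcont (isCompact_closedBall 0 1)
  · have hint : Integrable (Function.uncurry
        fun (θ : ℝ) (z : ℂ) => w z ^ p * ‖F (cir ζ ρ θ * z)‖ ^ 2)
        ((volume.restrict (uIoc 0 (2 * π))).prod (volume.restrict (closedBall (0:ℂ) 1))) := by
      rw [Measure.prod_restrict]
      refine IntegrableOn.mono_set (t := uIcc 0 (2 * π) ×ˢ closedBall (0:ℂ) 1) ?_
        (prod_mono uIoc_subset_uIcc subset_rfl)
      exact hcont.continuousOn.integrableOn_compact (isCompact_uIcc.prod (isCompact_closedBall 0 1))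
    have hi : ∀ k : ℂ → ℝ, Continuous k → Integrable fun z => w z ^ p * k z := fun k hk =>
      (hwp.mul hk).integrable_of_hasCompactSupport (rpow_supp hp h2).mul_right
    have e1 : ∫ θ in (0:ℝ)..2 * π, GG p F w (cir ζ ρ θ) =
        ∫ z in closedBall (0:ℂ) 1, ∫ θ in (0:ℝ)..2 * π, w z ^ p * ‖F (cir ζ ρ θ * z)‖ ^ 2 := by
      simp only [GG, hset]
      exact intervalIntegral_integral_swap hint
    rw [e1, ← integral_const_mul, GG, ← integral_add (hi _ (by fun_prop)) (hi _ (hh_cont hF ζ ρ))]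
    simp_rw [← mul_add]
    rw [hset]
    refine setIntegral_congr_fun measurableSet_closedBall fun z hz => ?_
    rw [intervalIntegral.integral_const_mul, mul_left_comm,
      mean_id hf hF hρ hr hFf (by simpa using hz)]

open Filter Topology in
/-- integrability of the supremum on the circle, and the averaged inequality -/
theorem avg_ge {p : ℝ} (hp : 1 ≤ p) {f : ℂ → ℂ} (hf : DifferentiableOn ℂ f (ball 0 1))
    (hinj : InjOn f (ball 0 1))
    {F : ℂ → ℂ} (hF : Continuous F) {ζ : ℂ} {ρ : ℝ} (hρ : 0 < ρ) (hr : ‖ζ‖ + ρ < 1)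
    (hFf : ∀ z ∈ closedBall (0:ℂ) (‖ζ‖ + ρ), F z = deriv f z) {M : ℝ}
    (hM : ∀ z ∈ closedBall (0:ℂ) (‖ζ‖ + ρ), ‖F z‖ ^ 2 ≤ M) {w : ℂ → ℝ}
    (hw : TF (ball 0 1) w) :
    GG p F w ζ / Dir w ^ (p / 2) + (∫ z, w z ^ p * hh F ζ ρ z) / Dir w ^ (p / 2) ≤
      (2 * π)⁻¹ * ∫ θ in (0:ℝ)..2 * π, Psi f p (cir ζ ρ θ) ^ (p / 2) := by
  have hπ := pi_pos
  have L := fun θ => lub hp hf hinj hF hr hFf hM (cir_norm ζ hρ θ)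
  obtain ⟨C, hC, hsob⟩ := sob p hp
  have hM0 : 0 ≤ M := le_trans (by positivity) (hM 0 (by simp; positivity))
  have hle : ∀ θ, Psi f p (cir ζ ρ θ) ^ (p / 2) ≤ M * C := by
    intro θ
    refine (L θ).2.2 ?_
    rintro _ ⟨v, hv, rfl⟩
    have hD := dir_pos hv
    rw [div_le_iff₀ (by positivity), mul_assoc]
    exact (GG_le hp hF hM hv (cir_norm ζ hρ θ)).trans
      (mul_le_mul_of_nonneg_left (hsob v hv) hM0)
  have hlsc : LowerSemicontinuous fun θ => Psi f p (cir ζ ρ θ) ^ (p / 2) := by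
    intro θ y hy
    obtain ⟨_, ⟨v, hv, rfl⟩, hlt⟩ := (lt_isLUB_iff (L θ).2).1 hy
    have hcv := (swap hp hf hF hρ hr hFf hv).1
    have : Continuous fun θ => GG p F v (cir ζ ρ θ) / Dir v ^ (p / 2) := hcv.div_const _
    filter_upwards [this.continuousAt.eventually (lt_mem_nhds hlt)] with t ht
    exact lt_of_lt_of_le ht ((L t).2.1 ⟨v, hv, rfl⟩)
  have hint : IntervalIntegrable (fun θ => Psi f p (cir ζ ρ θ) ^ (p / 2)) volume 0 (2 * π) := by
    refine (intervalIntegrable_const (c := M * C)).mono_fun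
      hlsc.measurable.aestronglyMeasurable ?_
    refine Filter.Eventually.of_forall fun θ => ?_
    beta_reduce
    rw [norm_of_nonneg (L θ).1.le]
    exact (hle θ).trans (le_abs_self _)
  have hs := swap hp hf hF hρ hr hFf hw
  rw [← add_div, ← hs.2, mul_div_assoc, ← intervalIntegral.integral_div]
  refine mul_le_mul_of_nonneg_left ?_ (by positivity)
  refine intervalIntegral.integral_mono_on (by positivity)
    ((hs.1.div_const _).intervalIntegrable _ _) hint ?_
  intro θ _
  exact (L θ).2.1 ⟨w, hw, rfl⟩

theorem vol_small (η : ℝ) (hη : 0 < η) : ∃ ε : ℝ, 0 < ε ∧ (volume (ball (0:ℂ) ε)).toReal ≤ η := by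
  have hπ := pi_pos
  refine ⟨√(η / π), by positivity, ?_⟩
  rw [Complex.volume_ball]
  simp only [ENNReal.toReal_mul, ENNReal.toReal_pow, ENNReal.toReal_ofReal (sqrt_nonneg _),
    sq_sqrt (by positivity : 0 ≤ η / π), ENNReal.coe_toReal, NNReal.coe_real_pi]
  exact le_of_eq (by field_simp)

/-- quantitative positivity of the defect for almost extremal functions -/
theorem gap {p : ℝ} (hp : 1 ≤ p) {h : ℂ → ℝ} (hc : Continuous h) (hn : ∀ z, 0 ≤ h z)
    (hpos : ∀ z, ‖z‖ ≤ 1 → z ≠ 0 → 0 < h z) {A : ℝ} (hA : 0 < A) :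
    ∃ δ : ℝ, 0 < δ ∧ ∀ w, TF (ball 0 1) w → A * Dir w ^ (p / 2) ≤ ∫ z, w z ^ p →
      δ ≤ (∫ z, w z ^ p * h z) / Dir w ^ (p / 2) := by
  obtain ⟨C, hC, hsob⟩ := sob (2 * p) (by linarith)
  set t : ℝ := A / (4 * C) with ht
  have ht0 : 0 < t := by positivity
  obtain ⟨ε, hε, hvol⟩ := vol_small (t * A) (by positivity)
  obtain ⟨c, hc0, hcle⟩ : ∃ c : ℝ, 0 < c ∧ ∀ z, ‖z‖ ≤ 1 → ε ≤ ‖z‖ → c ≤ h z := by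
    have hK : IsCompact (closedBall (0:ℂ) 1 \ ball 0 ε) :=
      (isCompact_closedBall 0 1).diff isOpen_ball
    rcases (closedBall (0:ℂ) 1 \ ball 0 ε).eq_empty_or_nonempty with he | hne
    · refine ⟨1, one_pos, fun z h1 h2 => ?_⟩
      have : z ∈ closedBall (0:ℂ) 1 \ ball 0 ε := by simp [h1, h2]
      rw [he] at this
      exact this.elim
    · obtain ⟨x, hx, hmin⟩ := hK.exists_isMinOn hne hc.continuousOn
      have hx1 : ‖x‖ ≤ 1 := by simpa using hx.1
      have hx2 : ε ≤ ‖x‖ := by simpa using hx.2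
      refine ⟨h x, hpos x hx1 (fun e => by simp [e] at hx2; linarith), fun z h1 h2 => ?_⟩
      exact hmin (show z ∈ closedBall (0:ℂ) 1 \ ball 0 ε by simp [h1, h2])
  refine ⟨c * (A / 2), by positivity, ?_⟩
  intro w hw hAw
  have hD := dir_pos hw
  have hs2 := hsob w hw
  obtain ⟨h1, h2, h3, h4, h5⟩ := hw
  set s := Dir w ^ (p / 2) with hs
  have hs0 : 0 < s := by positivity
  have hss : Dir w ^ (2 * p / 2) = s ^ 2 := by
    rw [hs, ← rpow_natCast, ← rpow_mul hD.le]; congr 1; push_cast; ring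
  rw [hss] at hs2
  have hp0 : p ≠ 0 := by linarith
  have hpt : ∀ z, w z ^ p ≤ c⁻¹ * (w z ^ p * h z) + (t / s) * w z ^ (2 * p) +
      (ball (0:ℂ) ε).indicator (fun _ => s / (4 * t)) z := by
    intro z
    have ha : 0 ≤ w z ^ p := rpow_nonneg (h4 z) _
    have hsq : w z ^ (2 * p) = (w z ^ p) ^ 2 := by
      rw [← rpow_natCast, ← rpow_mul (h4 z)]; congr 1; push_cast; ring
    rw [hsq]
    set a := w z ^ p with haa
    have hhz := hn z
    by_cases hz : z ∈ ball (0:ℂ) ε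
    · rw [indicator_of_mem hz]
      have e1 : 0 ≤ c⁻¹ * (a * h z) := by positivity
      have e2 : t / s * a ^ 2 + s / (4 * t) - a = (2 * t * a - s) ^ 2 / (4 * t * s) := by
        field_simp; ring
      have e3 : 0 ≤ (2 * t * a - s) ^ 2 / (4 * t * s) := by positivity
      linarith
    · rw [indicator_of_notMem hz]
      have e1 : 0 ≤ t / s * a ^ 2 := by positivity
      by_cases hz1 : z ∈ ball (0:ℂ) 1
      · have := hcle z (mem_ball_zero_iff.1 hz1).le (by simpa using hz)
        have e2 : a ≤ c⁻¹ * (a * h z) := by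
          rw [inv_mul_eq_div, le_div_iff₀ hc0]
          exact mul_le_mul_of_nonneg_left this ha
        linarith
      · have hw0 : w z = 0 := image_eq_zero_of_notMem_tsupport (fun h => hz1 (h3 h))
        have : a = 0 := by rw [haa, hw0, zero_rpow hp0]
        simp [this]
  have i1 : Integrable fun z => w z ^ p :=
    (rpow_cont hp h1.continuous).integrable_of_hasCompactSupport (rpow_supp hp h2)
  have i2 : Integrable fun z => w z ^ p * h z :=
    ((rpow_cont hp h1.continuous).mul hc).integrable_of_hasCompactSupport
      (rpow_supp hp h2).mul_right
  have hp2 : 1 ≤ 2 * p := by linarith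
  have i3 : Integrable fun z => w z ^ (2 * p) :=
    (rpow_cont hp2 h1.continuous).integrable_of_hasCompactSupport (rpow_supp hp2 h2)
  have i4 : Integrable ((ball (0:ℂ) ε).indicator (fun _ => s / (4 * t))) := by
    rw [integrable_indicator_iff measurableSet_ball]
    exact integrableOn_const measure_ball_lt_top.ne
  have hI := integral_mono i1 (((i2.const_mul c⁻¹).add (i3.const_mul (t / s))).add i4) hpt
  have hI2 : ∫ z, w z ^ p ≤ c⁻¹ * (∫ z, w z ^ p * h z) + (t / s) * (∫ z, w z ^ (2 * p)) +
      (volume (ball (0:ℂ) ε)).toReal * (s / (4 * t)) := by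
    refine hI.trans (le_of_eq ?_)
    have e1 := integral_add ((i2.const_mul c⁻¹).add (i3.const_mul (t / s))) i4
    have e2 := integral_add (i2.const_mul c⁻¹) (i3.const_mul (t / s))
    simp only [Pi.add_apply] at e1 e2 ⊢
    rw [e1, e2, integral_const_mul, integral_const_mul, integral_indicator measurableSet_ball,
      setIntegral_const]
    simp [Measure.real]
  have b1 : (t / s) * (∫ z, w z ^ (2 * p)) ≤ A / 4 * s := by
    calc _ ≤ (t / s) * (C * s ^ 2) := by gcongr
      _ = A / 4 * s := by rw [ht]; field_simp
  have b2 : (volume (ball (0:ℂ) ε)).toReal * (s / (4 * t)) ≤ A / 4 * s := by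
    calc _ ≤ (t * A) * (s / (4 * t)) := by gcongr
      _ = A / 4 * s := by field_simp
  have b3 : A / 2 * s ≤ c⁻¹ * (∫ z, w z ^ p * h z) := by linarith
  rw [le_div_iff₀ hs0, mul_assoc]
  rwa [inv_mul_eq_div, le_div_iff₀ hc0, mul_comm] at b3

/-- For a conformal map `f` of the unit disk, `Ψ^{p/2}` is subharmonic on `𝔻`
(it satisfies the sub-mean value inequality on every circle contained in `𝔻`), and
strictly subharmonic unless `f` is linear. -/
theorem Psi_subharmonic (p : ℝ) (hp : 1 ≤ p) (f : ℂ → ℂ)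
    (hf : DifferentiableOn ℂ f (ball 0 1)) (hinj : Set.InjOn f (ball 0 1)) :
    (∀ ζ ∈ ball (0 : ℂ) 1, ∀ ρ : ℝ, 0 < ρ → ρ < 1 - ‖ζ‖ →
      Psi f p ζ ^ (p / 2) ≤ (2 * π)⁻¹ *
        ∫ θ in (0 : ℝ)..2 * π, Psi f p (ζ + (ρ : ℂ) * Complex.exp (θ * Complex.I)) ^ (p / 2)) ∧
    (¬ (∃ a b : ℂ, ∀ z ∈ ball (0 : ℂ) 1, f z = a * z + b) →
      ∀ ζ ∈ ball (0 : ℂ) 1, ∀ ρ : ℝ, 0 < ρ → ρ < 1 - ‖ζ‖ →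
      Psi f p ζ ^ (p / 2) < (2 * π)⁻¹ *
        ∫ θ in (0 : ℝ)..2 * π, Psi f p (ζ + (ρ : ℂ) * Complex.exp (θ * Complex.I)) ^ (p / 2)) := by
  have hsetup : ∀ ζ ∈ ball (0 : ℂ) 1, ∀ ρ : ℝ, 0 < ρ → ρ < 1 - ‖ζ‖ →
      ∃ (F : ℂ → ℂ) (M : ℝ), Continuous F ∧
        (∀ z ∈ closedBall (0:ℂ) (‖ζ‖ + ρ), F z = deriv f z) ∧ 0 < M ∧
        (∀ z ∈ closedBall (0:ℂ) (‖ζ‖ + ρ), ‖F z‖ ^ 2 ≤ M) := by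
    intro ζ _ ρ hρ hr
    obtain ⟨F, hF, hFf⟩ := exists_ext hf (r := ‖ζ‖ + ρ) (by linarith)
    obtain ⟨M, hM⟩ := (isCompact_closedBall (0:ℂ) (‖ζ‖ + ρ)).bddAbove_image
      (f := fun z => ‖F z‖ ^ 2) (by fun_prop)
    refine ⟨F, |M| + 1, hF, hFf, by positivity, fun z hz => ?_⟩
    have := hM (mem_image_of_mem _ hz)
    linarith [le_abs_self M]
  refine ⟨?_, ?_⟩
  · intro ζ hζ ρ hρ hr
    obtain ⟨F, M, hF, hFf, hM0, hM⟩ := hsetup ζ hζ ρ hρ hr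
    have hr' : ‖ζ‖ + ρ < 1 := by linarith
    refine (lub hp hf hinj hF hr' hFf hM (ζ := ζ) (by linarith)).2.2 ?_
    rintro _ ⟨w, hw, rfl⟩
    have h1 := avg_ge hp hf hinj hF hρ hr' hFf hM hw
    have hD := dir_pos hw
    have h2 : 0 ≤ (∫ z, w z ^ p * hh F ζ ρ z) / Dir w ^ (p / 2) :=
      div_nonneg (integral_nonneg fun z =>
        mul_nonneg (rpow_nonneg (hw.2.2.2.1 z) _) (hh_nonneg F ζ ρ z)) (by positivity)
    exact le_trans (by linarith) h1
  · intro hna ζ hζ ρ hρ hr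
    obtain ⟨F, M, hF, hFf, hM0, hM⟩ := hsetup ζ hζ ρ hρ hr
    have hr' : ‖ζ‖ + ρ < 1 := by linarith
    have hζr : ‖ζ‖ ≤ ‖ζ‖ + ρ := by linarith
    obtain ⟨hpos, hlub⟩ := lub hp hf hinj hF hr' hFf hM hζr
    set Φ := Psi f p ζ ^ (p / 2) with hΦ
    obtain ⟨δ, hδ, hgap⟩ := gap hp (hh_cont hF ζ ρ) (hh_nonneg F ζ ρ)
      (fun z hz hz0 => hh_pos hf hna hF hρ hr' hFf hz hz0) (A := Φ / (2 * M)) (by positivity)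
    have hlt : max (Φ / 2) (Φ - δ) < Φ := max_lt (by linarith) (by linarith)
    obtain ⟨_, ⟨w, hw, rfl⟩, hlt⟩ := (lt_isLUB_iff hlub).1 hlt
    have hD := dir_pos hw
    have k1 : Φ / 2 < GG p F w ζ / Dir w ^ (p / 2) := lt_of_le_of_lt (le_max_left _ _) hlt
    have k2 : Φ - δ < GG p F w ζ / Dir w ^ (p / 2) := lt_of_le_of_lt (le_max_right _ _) hlt
    have k3 := GG_le hp hF hM hw hζr
    rw [lt_div_iff₀ (by positivity)] at k1
    have k4 := hgap w hw (by
      rw [div_mul_eq_mul_div, div_le_iff₀ (by positivity)]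
      linarith)
    have h1 := avg_ge hp hf hinj hF hρ hr' hFf hM hw
    exact lt_of_lt_of_le (by linarith) h1
end
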